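/- Let X ⊆ 𝔸^n_ℝ be an irreducible closed subvariety of dimension m ≥ 1 and degree d, with vanishing ideal I = I(X) ⊆ ℝ[x_1,…,x_n]. Then for every ε > 0 there exists a constant C = C(n,d,ε) such that for every B ≥ 1 there is a polynomial g ∈ ℤ[x_1,…,x_n] \ I of degree k ≤ C·B^{m·d^{−1/m}+ε}, all of whose irreducible factors have degree at most C, such that g(x) = 0 for every x ∈ X(ℤ,B). -/

import Mathlib

/-- The real zero set of an ideal of `ℝ[x_1,…,x_N]` in `ℝ^N`. -/
def zeroSetOf {N : ℕ} (I : Ideal (MvPolynomial (Fin N) ℝ)) : Set (Fin N → ℝ) :=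
  {x | ∀ f ∈ I, MvPolynomial.eval x f = 0}

/-- The vanishing ideal of a subset of `ℝ^N`. -/
noncomputable def vanishingIdeal {N : ℕ} (Z : Set (Fin N → ℝ)) : Ideal (MvPolynomial (Fin N) ℝ) where
  carrier := {f | ∀ x ∈ Z, MvPolynomial.eval x f = 0}
  add_mem' := by
    intro a b ha hb x hx
    simp [ha x hx, hb x hx]
  zero_mem' := by
    intro x hx
    simp
  smul_mem' := by
    intro c f hf x hx
    simp [smul_eq_mul, hf x hx]
/-- The affine Hilbert function of an ideal `I ⊆ K[x_1,…,x_N]`: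
`AHF_I(s) = dim_K (K[x_1,…,x_N]_{≤s} / I_{≤s})`.  For large `s` it agrees with the
Hilbert function of the homogenization of `I`. -/
noncomputable def affineHilbertFn {N : ℕ} (K : Type*) [Field K]
    (I : Ideal (MvPolynomial (Fin N) K)) (s : ℕ) : ℕ :=
  Module.finrank K
    (↥(MvPolynomial.restrictTotalDegree (Fin N) K s) ⧸
      (Submodule.comap (MvPolynomial.restrictTotalDegree (Fin N) K s).subtype
        (Submodule.restrictScalars K I)))

section Counting

open Filter Topology

/-- The exponent vectors of the monomials of total degree at most `s` in `r` variables. -/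
noncomputable def expLE (r s : ℕ) : Finset (Fin r →₀ ℕ) :=
  (Finset.range (s + 1)).biUnion fun j => Finset.finsuppAntidiag Finset.univ j

theorem mem_expLE {r s : ℕ} {γ : Fin r →₀ ℕ} : γ ∈ expLE r s ↔ γ.degree ≤ s := by
  simp [expLE, Finsupp.degree_eq_sum]

theorem card_expLE (r s : ℕ) : (expLE r s).card = (s + r).choose r := by
  rw [expLE, Finset.card_biUnion]
  · simp only [Finset.card_finsuppAntidiag_nat_eq_choose, Finset.card_univ, Fintype.card_fin]
    rw [add_comm s r, Nat.choose_symm_add]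
    induction s with
    | zero => simp
    | succ s ih =>
      rw [Finset.sum_range_succ, ih]
      rw [show r + (s + 1) - 1 = r + s by omega, show r + (s + 1) = (r + s) + 1 by omega,
        Nat.choose_succ_succ]
  · intro i _ j _ hij
    rw [Function.onFun, Finset.disjoint_left]
    intro γ h1 h2
    simp only [Finset.mem_finsuppAntidiag] at h1 h2
    exact hij (h1.1.symm.trans h2.1)

theorem sum_degree_expLE (m s : ℕ) :
    ∑ γ ∈ expLE m s, γ.degree + (s + m).choose (m + 1) = s * (s + m).choose m := by
  induction s with
  | zero =>
    simp only [zero_mul, zero_add, Nat.choose_succ_self, add_zero, Finset.sum_eq_zero_iff]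
    intro γ hγ
    simpa [mem_expLE] using hγ
  | succ s ih =>
    have hsub : expLE m s ⊆ expLE m (s + 1) := fun γ hγ => by
      rw [mem_expLE] at *; omega
    rw [← Finset.sum_sdiff hsub]
    have h1 : ∑ γ ∈ expLE m (s + 1) \ expLE m s, γ.degree =
        ((s + 1 + m).choose m - (s + m).choose m) * (s + 1) := by
      rw [← card_expLE m (s + 1), ← card_expLE m s, ← Finset.card_sdiff_of_subset hsub,
        ← smul_eq_mul, ← Finset.sum_const]
      refine Finset.sum_congr rfl fun γ hγ => ?_
      simp only [Finset.mem_sdiff, mem_expLE] at hγ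
      omega
    have h2 : (s + m).choose m ≤ (s + 1 + m).choose m := Nat.choose_le_choose _ (by omega)
    have h3 : (s + 1 + m).choose (m + 1) = (s + m).choose m + (s + m).choose (m + 1) := by
      rw [show s + 1 + m = (s + m) + 1 by omega, Nat.choose_succ_succ]
    rw [h1, h3]
    zify [h2] at ih ⊢
    linarith

theorem choose_add_mul_le (m D s : ℕ) :
    (s + m + 1).choose (m + 1) + D * (s + m).choose m ≤ (s + D + m + 1).choose (m + 1) := by
  induction D with
  | zero => simp
  | succ D ih =>
    have h : (s + (D + 1) + m + 1).choose (m + 1) =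
        (s + D + m + 1).choose m + (s + D + m + 1).choose (m + 1) := by
      rw [show s + (D + 1) + m + 1 = (s + D + m + 1) + 1 by omega, Nat.choose_succ_succ]
    have : (s + m).choose m ≤ (s + D + m + 1).choose m := Nat.choose_le_choose _ (by omega)
    linarith

theorem pow_le_choose_mul_factorial (s r : ℕ) : s ^ r ≤ (s + r).choose r * r.factorial := by
  have := Nat.pow_sub_le_descFactorial (s + r) r
  rw [Nat.descFactorial_eq_factorial_mul_choose, mul_comm] at this
  refine le_trans (Nat.pow_le_pow_left (by omega) _) this

theorem choose_mul_factorial_le_pow (s r : ℕ) :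
    (s + r).choose r * r.factorial ≤ (s + r) ^ r := by
  have := Nat.descFactorial_le_pow (s + r) r
  rwa [Nat.descFactorial_eq_factorial_mul_choose, mul_comm] at this

theorem tendsto_add_div_pow (c r : ℕ) :
    Tendsto (fun s : ℕ => ((s + c : ℝ) / s) ^ r) atTop (𝓝 1) := by
  have h : Tendsto (fun s : ℕ => (1 : ℝ) + c / s) atTop (𝓝 (1 + 0)) :=
    tendsto_const_nhds.add (tendsto_const_div_atTop_nhds_zero_nat _)
  have h2 := h.pow r
  simp only [add_zero, one_pow] at h2
  refine h2.congr' ?_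
  filter_upwards [eventually_gt_atTop 0] with s hs
  have : (s : ℝ) ≠ 0 := by positivity
  rw [add_div, div_self this]

/-- The number of monomials of degree at most `s + c` in `r` variables is `~ s ^ r / r!`. -/
theorem tendsto_choose_div_pow (c r : ℕ) :
    Tendsto (fun s : ℕ => ((s + c + r).choose r : ℝ) / s ^ r) atTop (𝓝 (1 / r.factorial)) := by
  have hf : (0 : ℝ) < r.factorial := by positivity
  have h1 := (tendsto_add_div_pow c r).div_const (r.factorial : ℝ)
  have h2 := (tendsto_add_div_pow (c + r) r).div_const (r.factorial : ℝ)
  refine tendsto_of_tendsto_of_tendsto_of_le_of_le' h1 h2 ?_ ?_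
  · filter_upwards [eventually_gt_atTop 0] with s hs
    have : (0 : ℝ) < (s : ℝ) ^ r := by positivity
    have h := pow_le_choose_mul_factorial (s + c) r
    have h : ((s + c : ℝ)) ^ r ≤ ((s + c + r).choose r : ℝ) * r.factorial := by exact_mod_cast h
    rw [div_pow, div_div, div_le_div_iff₀ (by positivity) this]
    nlinarith
  · filter_upwards [eventually_gt_atTop 0] with s hs
    have : (0 : ℝ) < (s : ℝ) ^ r := by positivity
    have h := choose_mul_factorial_le_pow (s + c) r
    have h : ((s + c + r).choose r : ℝ) * r.factorial ≤ ((s + c + r : ℝ)) ^ r := by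
      exact_mod_cast h
    push_cast
    rw [← add_assoc, div_pow, div_div, div_le_div_iff₀ this (by positivity)]
    nlinarith

theorem tendsto_shift_div_pow {f : ℕ → ℝ} {m : ℕ} {a : ℝ} (c : ℕ)
    (hf : Tendsto (fun s : ℕ => f s / s ^ m) atTop (𝓝 a)) :
    Tendsto (fun s : ℕ => f (s + c) / s ^ m) atTop (𝓝 a) := by
  have h1 : Tendsto (fun s : ℕ => f (s + c) / ((s + c : ℕ) : ℝ) ^ m) atTop (𝓝 a) :=
    hf.comp (tendsto_add_atTop_nat c)
  have h2 := h1.mul (tendsto_add_div_pow c m)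
  rw [mul_one] at h2
  refine h2.congr' ?_
  filter_upwards [eventually_gt_atTop 0] with s hs
  have h3 : (s : ℝ) ≠ 0 := by positivity
  have h4 : (s + c : ℝ) ≠ 0 := by positivity
  push_cast
  rw [div_pow]
  field_simp

variable {h : ℕ → ℕ} {m d : ℕ}

theorem le_of_choose_le_hilbert (hh : Tendsto (fun s : ℕ => (h s : ℝ) / s ^ m) atTop
    (𝓝 (d / m.factorial))) {D c : ℕ} (H : ∀ s, D * (s + m).choose m ≤ h (s + c)) : D ≤ d := by
  have h1 := (tendsto_choose_div_pow 0 m).const_mul (D : ℝ)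
  have h2 := tendsto_shift_div_pow (f := fun s => (h s : ℝ)) c hh
  have h3 := le_of_tendsto_of_tendsto' h1 h2 fun s => by
    rw [← mul_div_assoc]
    gcongr
    exact_mod_cast H s
  rw [mul_one_div, div_le_div_iff_of_pos_right (by positivity)] at h3
  exact_mod_cast h3

theorem le_of_hilbert_le_choose (hh : Tendsto (fun s : ℕ => (h s : ℝ) / s ^ m) atTop
    (𝓝 (d / m.factorial))) {e c : ℕ} (H : ∀ s, h s ≤ e * (s + c + m).choose m) : d ≤ e := by
  have h1 := (tendsto_choose_div_pow c m).const_mul (e : ℝ)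
  have h3 := le_of_tendsto_of_tendsto' hh h1 fun s => by
    rw [← mul_div_assoc]
    gcongr
    exact_mod_cast H s
  rw [mul_one_div, div_le_div_iff_of_pos_right (by positivity)] at h3
  exact_mod_cast h3

theorem exponent_le_of_choose_le_hilbert (hh : Tendsto (fun s : ℕ => (h s : ℝ) / s ^ m) atTop
    (𝓝 (d / m.factorial))) {r : ℕ} (H : ∀ s, (s + r).choose r ≤ h s) : r ≤ m := by
  by_contra! hlt
  have h1 := tendsto_choose_div_pow 0 r
  have h2 : Tendsto (fun s : ℕ => (h s : ℝ) / s ^ r) atTop (𝓝 0) := by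
    have h3 : Tendsto (fun s : ℕ => ((s : ℝ) ^ (r - m))⁻¹) atTop (𝓝 0) :=
      (tendsto_pow_atTop (by omega)).comp tendsto_natCast_atTop_atTop |>.inv_tendsto_atTop
    have h4 := hh.mul h3
    rw [mul_zero] at h4
    refine h4.congr fun s => ?_
    rw [div_mul_eq_mul_div, div_eq_mul_inv, mul_assoc, ← mul_inv, mul_comm _ ((s : ℝ) ^ m),
      ← pow_add, Nat.add_sub_cancel' hlt.le, div_eq_mul_inv]
  have h3 := le_of_tendsto_of_tendsto' h1 h2 fun s => by
    gcongr
    exact_mod_cast H s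
  have : (0 : ℝ) < 1 / r.factorial := by positivity
  linarith

theorem le_exponent_of_hilbert_le_choose (hd : d ≠ 0)
    (hh : Tendsto (fun s : ℕ => (h s : ℝ) / s ^ m) atTop
    (𝓝 (d / m.factorial))) {r c : ℕ} (H : ∀ s, h s ≤ c * (s + r).choose r) : m ≤ r := by
  by_contra! hlt
  have h1 := (tendsto_choose_div_pow 0 r).const_mul (c : ℝ)
  have h2 : Tendsto (fun s : ℕ => (c : ℝ) * ((s + r).choose r : ℝ) / s ^ m) atTop (𝓝 0) := by
    have h3 : Tendsto (fun s : ℕ => ((s : ℝ) ^ (m - r))⁻¹) atTop (𝓝 0) :=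
      (tendsto_pow_atTop (by omega)).comp tendsto_natCast_atTop_atTop |>.inv_tendsto_atTop
    have h4 := h1.mul h3
    rw [mul_zero] at h4
    refine h4.congr fun s => ?_
    rw [← mul_div_assoc, div_mul_eq_mul_div, div_eq_mul_inv, mul_assoc _ _ (_ ^ r)⁻¹, ← mul_inv,
      mul_comm _ ((s : ℝ) ^ r), ← pow_add, Nat.add_sub_cancel' hlt.le, div_eq_mul_inv, add_zero]
  have h3 := le_of_tendsto_of_tendsto' hh h2 fun s => by
    gcongr
    exact_mod_cast H s
  have : (0 : ℝ) < (d : ℝ) / m.factorial := by positivity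
  linarith

end Counting

section DegLE

open MvPolynomial

theorem MvPolynomial.totalDegree_aeval_le_mul {R σ τ : Type*} [CommRing R]
    (q : σ → MvPolynomial τ R) (D : ℕ) (hq : ∀ j, (q j).totalDegree ≤ D) (f : MvPolynomial σ R) :
    (aeval q f).totalDegree ≤ f.totalDegree * D := by
  rw [aeval_def, eval₂_eq]
  refine totalDegree_finsetSum_le fun γ hγ => ?_
  refine (totalDegree_mul _ _).trans ?_
  rw [algebraMap_eq, totalDegree_C, zero_add]
  refine (totalDegree_finsetProd _ _).trans ?_
  calc ∑ i ∈ γ.support, (q i ^ γ i).totalDegree ≤ ∑ i ∈ γ.support, γ i * D :=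
        Finset.sum_le_sum fun i _ => (totalDegree_pow _ _).trans (Nat.mul_le_mul_left _ (hq i))
    _ = (γ.sum fun _ e => e) * D := by rw [Finsupp.sum, Finset.sum_mul]
    _ ≤ _ := Nat.mul_le_mul_right _ (le_totalDegree hγ)

variable {k A : Type*} [Field k] [CommRing A] [Algebra k A]

variable (k) in
/-- The polynomial expressions of degree at most `s` in the elements `z i` of a `k`-algebra. -/
noncomputable def degLE {r : ℕ} (z : Fin r → A) (s : ℕ) : Submodule k A :=
  (restrictTotalDegree (Fin r) k s).map (aeval z).toLinearMap

theorem mem_degLE {r : ℕ} {z : Fin r → A} {s : ℕ} {a : A} :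
    a ∈ degLE k z s ↔ ∃ f : MvPolynomial (Fin r) k, f.totalDegree ≤ s ∧ aeval z f = a := by
  simp [degLE, mem_restrictTotalDegree]

instance {r : ℕ} (z : Fin r → A) (s : ℕ) : Module.Finite k (degLE k z s) := by
  unfold degLE; infer_instance

theorem degLE_mono {r : ℕ} (z : Fin r → A) {s t : ℕ} (h : s ≤ t) : degLE k z s ≤ degLE k z t := by
  intro a ha
  obtain ⟨f, hf, rfl⟩ := mem_degLE.1 ha
  exact mem_degLE.2 ⟨f, hf.trans h, rfl⟩

theorem mul_mem_degLE {r : ℕ} {z : Fin r → A} {s t : ℕ} {a b : A} (ha : a ∈ degLE k z s)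
    (hb : b ∈ degLE k z t) : a * b ∈ degLE k z (s + t) := by
  obtain ⟨f, hf, rfl⟩ := mem_degLE.1 ha
  obtain ⟨g, hg, rfl⟩ := mem_degLE.1 hb
  exact mem_degLE.2 ⟨f * g, (totalDegree_mul _ _).trans (add_le_add hf hg), by simp⟩

theorem one_mem_degLE {r : ℕ} (z : Fin r → A) (s : ℕ) : (1 : A) ∈ degLE k z s :=
  mem_degLE.2 ⟨1, by simp, by simp⟩

theorem apply_mem_degLE {r : ℕ} (z : Fin r → A) (i : Fin r) : z i ∈ degLE k z 1 :=
  mem_degLE.2 ⟨X i, (totalDegree_X i).le, by simp⟩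

theorem degLE_le_of_forall_mem {r r' : ℕ} {w : Fin r → A} {z : Fin r' → A}
    (h : ∀ j, w j ∈ degLE k z 1) (s : ℕ) : degLE k w s ≤ degLE k z s := by
  intro a ha
  obtain ⟨f, hf, rfl⟩ := mem_degLE.1 ha
  choose q hq1 hq2 using fun j => mem_degLE.1 (h j)
  refine mem_degLE.2 ⟨aeval q f, (totalDegree_aeval_le_mul q 1 hq1 f).trans (by simpa using hf), ?_⟩
  rw [← AlgHom.comp_apply, comp_aeval]
  simp only [hq2]

theorem MvPolynomial.finrank_restrictTotalDegree (r s : ℕ) :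
    Module.finrank k (restrictTotalDegree (Fin r) k s) = (s + r).choose r := by
  rw [← card_expLE]
  have e : {n : Fin r →₀ ℕ | (n.sum fun _ e => e) ≤ s} ≃ expLE r s :=
    Equiv.subtypeEquivRight fun γ => by
      rw [mem_expLE]; rfl
  have := (basisRestrictSupport k {n : Fin r →₀ ℕ | (n.sum fun _ e => e) ≤ s}).reindex e
  have h := Module.finrank_eq_card_basis this
  rw [Fintype.card_coe] at h
  exact h

theorem finrank_degLE_le {r : ℕ} (z : Fin r → A) (s : ℕ) :
    Module.finrank k (degLE k z s) ≤ (s + r).choose r := by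
  rw [← finrank_restrictTotalDegree (k := k)]
  exact Submodule.finrank_map_le _ _

theorem finrank_degLE_of_algebraicIndependent {r : ℕ} {z : Fin r → A}
    (hz : AlgebraicIndependent k z) (s : ℕ) :
    Module.finrank k (degLE k z s) = (s + r).choose r := by
  rw [← finrank_restrictTotalDegree (k := k)]
  exact (LinearEquiv.finrank_eq (Submodule.equivMapOfInjective (aeval z).toLinearMap hz _)).symm

theorem affineHilbertFn_eq {n : ℕ} (I : Ideal (MvPolynomial (Fin n) k)) (s : ℕ) :
    affineHilbertFn k I s =
      Module.finrank k (degLE k (fun i => Ideal.Quotient.mk I (X i)) s) := by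
  unfold affineHilbertFn degLE
  have h : (aeval (R := k) fun i => Ideal.Quotient.mk I (X i)) = Ideal.Quotient.mkₐ k I := by
    ext i; simp
  rw [h, ← LinearMap.range_domRestrict]
  refine LinearEquiv.finrank_eq ?_
  refine (Submodule.quotEquivOfEq _ _ ?_).trans (LinearMap.quotKerEquivRange _)
  ext f
  simp [Ideal.Quotient.eq_zero_iff_mem, LinearMap.mem_ker]

end DegLE

section Noether

open MvPolynomial

theorem Finsupp.induction_add_single {σ : Type*} {P : (σ →₀ ℕ) → Prop} (h0 : P 0)
    (hs : ∀ γ l, P γ → P (γ + Finsupp.single l 1)) (γ : σ →₀ ℕ) : P γ := by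
  classical
  induction hn : γ.degree generalizing γ with
  | zero => rwa [(Finsupp.degree_eq_zero_iff γ).1 hn]
  | succ n ih =>
    obtain ⟨l, hl⟩ : ∃ l, γ l ≠ 0 := by
      by_contra! H
      rw [show γ = 0 from Finsupp.ext H] at hn
      simp at hn
    have hle : Finsupp.single l 1 ≤ γ := Finsupp.single_le_iff.2 (Nat.one_le_iff_ne_zero.2 hl)
    rw [← tsub_add_cancel_of_le hle] at hn ⊢
    refine hs _ _ (ih _ ?_)
    rw [map_add, Finsupp.degree_single] at hn
    omega

variable {k A : Type*} [Field k] [CommRing A] [Algebra k A]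

/-- A point with coordinates in `{0, …, D}` at which a nonzero polynomial of degree `≤ D`
does not vanish. -/
theorem MvPolynomial.exists_natCast_eval_ne_zero [CharZero k] {σ : Type*} [Finite σ] {D : ℕ}
    {f : MvPolynomial σ k} (hf : f ≠ 0) (hD : f.totalDegree ≤ D) :
    ∃ c : σ → ℕ, (∀ i, c i ≤ D) ∧ eval (fun i => (c i : k)) f ≠ 0 := by
  by_contra! H
  refine hf (eq_zero_of_eval_zero_at_prod_finset f
    (fun _ => (Finset.range (D + 1)).map Nat.castEmbedding) (fun i => ?_) fun x hx => ?_)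
  · rw [Finset.card_map, Finset.card_range]
    exact Nat.lt_succ_of_le ((degreeOf_le_totalDegree f i).trans hD)
  · choose c hc1 hc2 using fun i => Finset.mem_map.1 (hx i)
    rw [← _root_.funext hc2]
    exact H c fun i => Nat.lt_succ_iff.1 (Finset.mem_range.1 (hc1 i))

theorem MvPolynomial.homogeneousComponent_totalDegree_ne_zero {σ : Type*} {f : MvPolynomial σ k}
    (hf : f ≠ 0) : homogeneousComponent f.totalDegree f ≠ 0 := by
  obtain ⟨γ, hγ, h⟩ := Finset.exists_mem_eq_sup f.support (support_nonempty.2 hf)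
    (fun s => s.sum fun _ e => e)
  intro h0
  have := congrArg (coeff γ) h0
  rw [coeff_homogeneousComponent, if_pos] at this
  · exact (mem_support_iff.1 hγ) this
  · exact h.symm

theorem degLE_le_of_mul_mem {r : ℕ} {z : Fin r → A} {N : ℕ → Submodule k A}
    (h1 : (1 : A) ∈ N 0) (hmono : Monotone N) (hz : ∀ l s, ∀ x ∈ N s, z l * x ∈ N (s + 1)) (s : ℕ) :
    degLE k z s ≤ N s := by
  have key : ∀ γ : Fin r →₀ ℕ, aeval z (monomial γ (1 : k)) ∈ N γ.degree := by
    intro γ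
    induction γ using Finsupp.induction_add_single with
    | h0 => simpa using h1
    | hs γ l ih =>
      have : aeval z (monomial (γ + Finsupp.single l 1) (1 : k)) =
          z l * aeval z (monomial γ (1 : k)) := by
        rw [show monomial (γ + Finsupp.single l 1) (1 : k) = monomial γ 1 * X l by
          rw [X, monomial_mul, one_mul], map_mul, aeval_X, mul_comm]
      rw [this, map_add, Finsupp.degree_single]
      exact hz _ _ _ ih
  intro a ha
  obtain ⟨f, hf, rfl⟩ := mem_degLE.1 ha
  rw [f.as_sum, map_sum]
  refine Submodule.sum_mem _ fun γ hγ => ?_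
  rw [← mul_one (coeff γ f), ← smul_eq_mul, ← smul_monomial, map_smul]
  exact Submodule.smul_mem _ _ (hmono ((le_totalDegree hγ).trans hf) (key γ))

/-- The span of the products `t ^ i * u` with `i < D`, where `u` has degree at most `s - i`
in the `z j`. -/
noncomputable def powSpan (k : Type*) {A : Type*} [Field k] [CommRing A] [Algebra k A]
    (t : A) {r : ℕ} (z : Fin r → A) (D s : ℕ) : Submodule k A :=
  Submodule.span k {x | ∃ i u, i < D ∧ i ≤ s ∧ u ∈ degLE k z (s - i) ∧ x = t ^ i * u}

section powSpan

variable {t : A} {r : ℕ} {z : Fin r → A}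

theorem pow_mul_mem_powSpan {D s i : ℕ} {u : A} (hi : i < D) (his : i ≤ s)
    (hu : u ∈ degLE k z (s - i)) : t ^ i * u ∈ powSpan k t z D s :=
  Submodule.subset_span ⟨i, u, hi, his, hu, rfl⟩

theorem pow_mem_powSpan {D s i : ℕ} (hi : i < D) (his : i ≤ s) :
    t ^ i ∈ powSpan k t z D s := by
  simpa using pow_mul_mem_powSpan (t := t) hi his (one_mem_degLE (k := k) z (s - i))

theorem powSpan_mono {D D' s s' : ℕ} (hD : D ≤ D') (hs : s ≤ s') :
    powSpan k t z D s ≤ powSpan k t z D' s' := by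
  refine Submodule.span_le.2 ?_
  rintro _ ⟨i, u, hi, his, hu, rfl⟩
  exact pow_mul_mem_powSpan (by omega) (by omega) (degLE_mono z (by omega) hu)

theorem mul_mem_powSpan {D s a : ℕ} {u x : A} (hu : u ∈ degLE k z a)
    (hx : x ∈ powSpan k t z D s) : u * x ∈ powSpan k t z D (s + a) := by
  induction hx using Submodule.span_induction with
  | mem x hx =>
    obtain ⟨i, v, hi, his, hv, rfl⟩ := hx
    rw [mul_left_comm]
    refine pow_mul_mem_powSpan hi (by omega) (degLE_mono z ?_ (mul_mem_degLE hu hv))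
    omega
  | zero => simp
  | add x y _ _ hx hy => rw [mul_add]; exact add_mem hx hy
  | smul c x _ hx => rw [mul_smul_comm]; exact Submodule.smul_mem _ _ hx

theorem self_mul_mem_powSpan {D s : ℕ} {x : A} (hx : x ∈ powSpan k t z D s) :
    t * x ∈ powSpan k t z (D + 1) (s + 1) := by
  induction hx using Submodule.span_induction with
  | mem x hx =>
    obtain ⟨i, v, hi, his, hv, rfl⟩ := hx
    rw [← mul_assoc, ← pow_succ']
    exact pow_mul_mem_powSpan (by omega) (by omega) (by simpa using hv)
  | zero => simp
  | add x y _ _ hx hy => rw [mul_add]; exact add_mem hx hy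
  | smul c x _ hx => rw [mul_smul_comm]; exact Submodule.smul_mem _ _ hx

theorem self_mul_mem_powSpan_of_pow_mem {D s : ℕ} (h : t ^ D ∈ powSpan k t z D D) {x : A}
    (hx : x ∈ powSpan k t z D s) : t * x ∈ powSpan k t z D (s + 1) := by
  induction hx using Submodule.span_induction with
  | mem x hx =>
    obtain ⟨i, v, hi, his, hv, rfl⟩ := hx
    rw [← mul_assoc, ← pow_succ']
    rcases Nat.lt_or_ge (i + 1) D with hlt | hge
    · exact pow_mul_mem_powSpan hlt (by omega) (by simpa using hv)
    · obtain rfl : D = i + 1 := by omega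
      rw [mul_comm]
      exact powSpan_mono le_rfl (by omega) (mul_mem_powSpan hv h)
  | zero => simp
  | add x y _ _ hx hy => rw [mul_add]; exact add_mem hx hy
  | smul c x _ hx => rw [mul_smul_comm]; exact Submodule.smul_mem _ _ hx

theorem powSpan_le_mul (D s : ℕ) :
    powSpan k t z D s ≤ Submodule.span k ((fun i => t ^ i) '' Set.Iio D) * degLE k z s := by
  refine Submodule.span_le.2 ?_
  rintro _ ⟨i, u, hi, his, hu, rfl⟩
  exact Submodule.mul_mem_mul (Submodule.subset_span ⟨i, hi, rfl⟩) (degLE_mono z (by omega) hu)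

end powSpan

/-- One step of Noether normalization, compatible with the filtration by degree: given a relation
of degree at most `D` between `r + 1` elements, `r` explicit small integer combinations of
them suffice. -/
theorem exists_noether_step [CharZero k] [Nontrivial A] {r D : ℕ} (z : Fin (r + 1) → A)
    {G : MvPolynomial (Fin (r + 1)) k} (hG : G ≠ 0) (hz : aeval z G = 0) (hD : G.totalDegree ≤ D) :
    ∃ (c : Fin (r + 1) → ℕ) (j : Fin (r + 1)) (M : Submodule k A), (∀ i, c i ≤ D) ∧ M.FG ∧
      ∀ s, degLE k z s ≤ M * degLE k
        (fun i => (c j : A) * z (j.succAbove i) - (c (j.succAbove i) : A) * z j) s := by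
  set E := G.totalDegree with hE
  have hE0 : E ≠ 0 := by
    intro h0
    obtain ⟨a, rfl⟩ : ∃ a, G = C a := ⟨_, totalDegree_eq_zero_iff_eq_C.1 h0⟩
    rw [aeval_C] at hz
    rw [(map_eq_zero_iff _ (algebraMap k A).injective).1 hz, C_0] at hG
    exact hG rfl
  have htop := homogeneousComponent_totalDegree_ne_zero hG
  have htopdeg := (homogeneousComponent_isHomogeneous E G)
  obtain ⟨c, hc, hcne⟩ := exists_natCast_eval_ne_zero htop (htopdeg.totalDegree_le.trans hD)
  rw [← hE] at hcne
  obtain ⟨j, hj⟩ : ∃ j, c j ≠ 0 := by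
    by_contra! H
    apply hcne
    simp only [H, Nat.cast_zero]
    change eval (0 : Fin (r + 1) → k) _ = 0
    rw [eval_zero, constantCoeff_eq, coeff_homogeneousComponent, if_neg (by simpa using hE0.symm)]
  have hjk : (c j : k) ≠ 0 := by exact_mod_cast hj
  set z' : Fin r → A := fun i => (c j : A) * z (j.succAbove i) - (c (j.succAbove i) : A) * z j
    with hz'
  set t : A := (c j : k)⁻¹ • z j with ht
  have hsub : ∀ l, z l - (c l : k) • t ∈ degLE k z' 1 := by
    intro l
    rcases Fin.eq_self_or_eq_succAbove j l with rfl | ⟨i, rfl⟩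
    · simp [ht, smul_smul, hjk]
    · have : z (j.succAbove i) - (c (j.succAbove i) : k) • t = (c j : k)⁻¹ • z' i := by
        simp only [hz', ht, smul_sub, smul_smul, ← nsmul_eq_mul, ← Nat.cast_smul_eq_nsmul k]
        rw [inv_mul_cancel₀ hjk, one_smul, mul_comm]
        rfl
      rw [this]
      exact Submodule.smul_mem _ _ (apply_mem_degLE z' i)
  have key : ∀ γ : Fin (r + 1) →₀ ℕ, aeval z (monomial γ (1 : k)) -
      (eval (fun i => (c i : k)) (monomial γ (1 : k))) • t ^ γ.degree ∈
        powSpan k t z' γ.degree γ.degree := by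
    intro γ
    induction γ using Finsupp.induction_add_single with
    | h0 => simp
    | hs γ l ih =>
      have h1 : monomial (γ + Finsupp.single l 1) (1 : k) = X l * monomial γ 1 := by
        rw [X, monomial_mul, one_mul, add_comm γ]
      rw [h1, map_mul, map_mul, aeval_X, eval_X, map_add, Finsupp.degree_single]
      set x := aeval z (monomial γ (1 : k))
      set a := eval (fun i => (c i : k)) (monomial γ (1 : k))
      set e := γ.degree
      have h2 : z l * x - ((c l : k) * a) • t ^ (e + 1) =
          (z l - (c l : k) • t) * (x - a • t ^ e) + (c l : k) • (t * (x - a • t ^ e)) +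
            a • (t ^ e * (z l - (c l : k) • t)) := by
        simp only [Algebra.smul_def, map_mul]
        ring
      rw [h2]
      refine add_mem (add_mem ?_ ?_) ?_
      · exact powSpan_mono (by omega) le_rfl (mul_mem_powSpan (hsub l) ih)
      · exact Submodule.smul_mem _ _ (self_mul_mem_powSpan ih)
      · exact Submodule.smul_mem _ _ (pow_mul_mem_powSpan (by omega) (by omega)
          (by simpa using hsub l))
  have htE : t ^ E ∈ powSpan k t z' E E := by
    have h1 : aeval z G - eval (fun i => (c i : k)) (homogeneousComponent E G) • t ^ E ∈
        powSpan k t z' E E := by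
      have h2 : eval (fun i => (c i : k)) (homogeneousComponent E G) =
          ∑ γ ∈ G.support, if γ.degree = E then
            coeff γ G * eval (fun i => (c i : k)) (monomial γ (1 : k)) else 0 := by
        rw [homogeneousComponent_apply, map_sum, Finset.sum_filter]
        refine Finset.sum_congr rfl fun γ _ => ?_
        split_ifs
        · simp [eval_monomial]
        · rfl
      have h0 : aeval z G = ∑ γ ∈ G.support, aeval z (monomial γ (coeff γ G)) := by
        rw [← map_sum, ← G.as_sum]
      rw [h2, h0, Finset.sum_smul, ← Finset.sum_sub_distrib]
      refine Submodule.sum_mem _ fun γ hγ => ?_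
      have h3 : aeval z (monomial γ (coeff γ G)) = coeff γ G • aeval z (monomial γ (1 : k)) := by
        rw [← map_smul, smul_monomial, smul_eq_mul, mul_one]
      have hdeg : γ.degree ≤ E := le_totalDegree hγ
      rw [h3]
      split_ifs with hγE
      · rw [mul_smul, ← smul_sub, ← hγE]
        exact Submodule.smul_mem _ _ (key γ)
      · rw [zero_smul, sub_zero]
        refine Submodule.smul_mem _ _ ?_
        have := add_mem (powSpan_mono hdeg hdeg (key γ))
          (Submodule.smul_mem _ (eval (fun i => (c i : k)) (monomial γ (1 : k)))
            (pow_mem_powSpan (k := k) (t := t) (z := z') (lt_of_le_of_ne hdeg hγE) hdeg))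
        simpa using this
    rw [hz, zero_sub, ← neg_smul] at h1
    exact (Submodule.smul_mem_iff _ (neg_ne_zero.2 hcne)).1 h1
  refine ⟨c, j, Submodule.span k ((fun i => t ^ i) '' Set.Iio E), hc,
    Submodule.fg_span ((Set.finite_Iio E).image _), fun s => ?_⟩
  refine le_trans ?_ (powSpan_le_mul E s)
  refine degLE_le_of_mul_mem (N := fun s => powSpan k t z' E s) ?_ (fun a b h => powSpan_mono le_rfl h)
    (fun l s x hx => ?_) s
  · simpa using pow_mem_powSpan (k := k) (t := t) (z := z') (i := 0) (s := 0)
      (Nat.pos_of_ne_zero hE0) le_rfl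
  · have : z l * x = (z l - (c l : k) • t) * x + (c l : k) • (t * x) := by
      simp only [Algebra.smul_def]
      ring
    rw [this]
    exact add_mem (mul_mem_powSpan (hsub l) hx)
      (Submodule.smul_mem _ _ (self_mul_mem_powSpan_of_pow_mem htE hx))

end Noether

section Hypersurface

open Polynomial in
theorem Polynomial.exists_prime_aeval_eq_zero_iff {R L : Type*} [CommRing R] [IsDomain R]
    [UniqueFactorizationMonoid R] [Field L] [Algebra R L]
    [FaithfulSMul R L] {a : L} (ha : IsAlgebraic R a) :
    ∃ g : R[X], Prime g ∧ ∀ f : R[X], aeval a f = 0 ↔ g ∣ f := by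
  let P : Ideal R[X] := RingHom.ker (aeval a)
  have hP : P.IsPrime := RingHom.ker_isPrime _
  have hP0 : P ≠ ⊥ := by
    obtain ⟨p, hp, hpa⟩ := ha
    exact fun h => hp (by simpa [h] using (show p ∈ P from hpa))
  obtain ⟨g, hgP, hg⟩ := hP.exists_mem_prime_of_ne_bot hP0
  have hga : aeval a g = 0 := hgP
  have hdeg : g.natDegree ≠ 0 := by
    intro h0
    obtain ⟨r, rfl⟩ := natDegree_eq_zero.1 h0
    rw [aeval_C, FaithfulSMul.algebraMap_eq_zero_iff] at hga
    exact hg.ne_zero (by simp [hga])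
  have hprim := hg.irreducible.isPrimitive hdeg
  let := FractionRing.liftAlgebra R L
  have hirr := (hprim.irreducible_iff_irreducible_map_fraction_map (K := FractionRing R)).1
    hg.irreducible
  refine ⟨g, hg, fun f => ⟨fun hf => ?_, fun ⟨q, hq⟩ => by rw [hq, map_mul, hga, zero_mul]⟩⟩
  refine hprim.dvd_of_fraction_map_dvd_fraction_map (K := FractionRing R) ?_
  have h1 := minpoly.eq_of_irreducible hirr (x := a) (by rwa [aeval_map_algebraMap])
  have h2 : minpoly (FractionRing R) a ∣ f.map (algebraMap R (FractionRing R)) :=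
    minpoly.dvd _ _ (by rwa [aeval_map_algebraMap])
  rw [← h1] at h2
  exact dvd_of_mul_right_dvd h2

open MvPolynomial

theorem MvPolynomial.aeval_eq_polynomial_aeval_finSuccEquiv {k A : Type*} [Field k] [CommRing A]
    [Algebra k A] {m : ℕ} (w : Fin (m + 1) → A) (f : MvPolynomial (Fin (m + 1)) k) :
    aeval w f = Polynomial.eval₂ (aeval (fun i => w i.succ) : MvPolynomial (Fin m) k →ₐ[k] A).toRingHom (w 0)
      (finSuccEquiv k m f) := by
  induction f using MvPolynomial.induction_on with
  | C a => simp [finSuccEquiv_apply]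
  | add p q hp hq => rw [map_add, map_add, Polynomial.eval₂_add, hp, hq]
  | mul_X p i hp =>
    rw [map_mul, map_mul, Polynomial.eval₂_mul, hp, aeval_X]
    congr 1
    refine Fin.cases ?_ (fun j => ?_) i
    · simp [finSuccEquiv_X_zero]
    · simp [finSuccEquiv_X_succ]

variable {k L : Type*} [Field k] [Field L] [Algebra k L]

/-- The ideal of relations between `m + 1` elements of a field, the last `m` of which are
algebraically independent, is principal. -/
theorem exists_aeval_eq_zero_iff_dvd {m : ℕ} {w : Fin (m + 1) → L}
    (hy : AlgebraicIndependent k fun i : Fin m => w i.succ)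
    (hw : ¬ AlgebraicIndependent k w) :
    ∃ G : MvPolynomial (Fin (m + 1)) k, G ≠ 0 ∧ ∀ f, aeval w f = 0 ↔ G ∣ f := by
  let : Algebra (MvPolynomial (Fin m) k) L := (aeval fun i : Fin m => w i.succ).toAlgebra
  have hmap : algebraMap (MvPolynomial (Fin m) k) L =
    (aeval (fun i => w i.succ) : MvPolynomial (Fin m) k →ₐ[k] L).toRingHom := rfl
  have : FaithfulSMul (MvPolynomial (Fin m) k) L := (faithfulSMul_iff_algebraMap_injective _ _).2 hy
  have key : ∀ f, aeval w f = Polynomial.aeval (w 0) (finSuccEquiv k m f) := fun f => by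
    rw [aeval_eq_polynomial_aeval_finSuccEquiv, Polynomial.aeval_def, hmap]
  have halg : IsAlgebraic (MvPolynomial (Fin m) k) (w 0) := by
    rw [algebraicIndependent_iff] at hw
    push Not at hw
    obtain ⟨p, hp, hp0⟩ := hw
    exact ⟨finSuccEquiv k m p, by simpa using hp0, by rw [← key, hp]⟩
  obtain ⟨g, hg, hgf⟩ := Polynomial.exists_prime_aeval_eq_zero_iff halg
  refine ⟨(finSuccEquiv k m).symm g, by simpa using hg.ne_zero, fun f => ?_⟩
  rw [key, hgf, ← map_dvd_iff (finSuccEquiv k m) (a := (finSuccEquiv k m).symm g)]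
  simp

theorem choose_le_choose_add_finrank_degLE {m : ℕ} {w : Fin (m + 1) → L}
    {G : MvPolynomial (Fin (m + 1)) k} (hG0 : G ≠ 0) (hG : ∀ f, aeval w f = 0 ↔ G ∣ f) (s : ℕ) :
    G.totalDegree * (s + m).choose m ≤ Module.finrank k (degLE k w (s + G.totalDegree)) := by
  set D := G.totalDegree with hD
  let φ : restrictTotalDegree (Fin (m + 1)) k (s + D) →ₗ[k] L :=
    (aeval w).toLinearMap.domRestrict _
  have h1 := φ.finrank_range_add_finrank_ker
  rw [finrank_restrictTotalDegree] at h1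
  have h2 : LinearMap.range φ = degLE k w (s + D) := LinearMap.range_domRestrict _ _
  rw [h2] at h1
  have h3 : Module.finrank k (LinearMap.ker φ) ≤ (s + (m + 1)).choose (m + 1) := by
    rw [← finrank_restrictTotalDegree (k := k)]
    have hq : ∀ f : LinearMap.ker φ, ∃ q : MvPolynomial (Fin (m + 1)) k,
        (f.1 : MvPolynomial (Fin (m + 1)) k) = G * q := fun f => (hG _).1 f.2
    choose q hq using hq
    have hinj : Function.Injective fun x : MvPolynomial (Fin (m + 1)) k => G * x :=
      fun a b h => mul_left_cancel₀ hG0 h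
    let ψ : LinearMap.ker φ →ₗ[k] restrictTotalDegree (Fin (m + 1)) k s :=
      { toFun := fun f => ⟨q f, by
          rw [mem_restrictTotalDegree]
          by_cases h0 : q f = 0
          · simp [h0]
          have h4 := (mem_restrictTotalDegree _ _ _).1 f.1.2
          rw [hq, totalDegree_mul_of_isDomain hG0 h0] at h4
          omega⟩
        map_add' := fun f g => Subtype.ext <| hinj <| by
          simp only [Submodule.coe_add, mul_add, ← hq]
        map_smul' := fun c f => Subtype.ext <| hinj <| by
          simp only [SetLike.val_smul, RingHom.id_apply, mul_smul_comm, ← hq] }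
    refine LinearMap.finrank_le_finrank_of_injective (f := ψ) fun f g h => ?_
    have h5 : q f = q g := congrArg Subtype.val h
    exact Subtype.ext (Subtype.ext (by rw [hq, hq, h5]))
  have h4 := choose_add_mul_le m D s
  have e1 : s + D + (m + 1) = s + D + m + 1 := rfl
  have e2 : s + (m + 1) = s + m + 1 := rfl
  rw [e1] at h1
  rw [e2] at h3
  omega

/-- If the Hilbert function of `x` grows like `d * s ^ m / m!`, then `m + 1` linear forms in `x`,
the last `m` of which are algebraically independent, satisfy an equation of degree `≤ d`. -/
theorem exists_relation_totalDegree_le {n m d : ℕ} {x : Fin n → L}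
    (hh : Filter.Tendsto (fun s : ℕ => (Module.finrank k (degLE k x s) : ℝ) / s ^ m) Filter.atTop
      (nhds (d / m.factorial))) {w : Fin (m + 1) → L} (hwx : ∀ i, w i ∈ degLE k x 1)
    (hy : AlgebraicIndependent k fun i : Fin m => w i.succ)
    (hw : ¬ AlgebraicIndependent k w) :
    ∃ G : MvPolynomial (Fin (m + 1)) k, G ≠ 0 ∧ aeval w G = 0 ∧ G.totalDegree ≤ d := by
  obtain ⟨G, hG0, hG⟩ := exists_aeval_eq_zero_iff_dvd hy hw
  refine ⟨G, hG0, (hG G).2 dvd_rfl, le_of_choose_le_hilbert hh (c := G.totalDegree) fun s => ?_⟩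
  exact (choose_le_choose_add_finrank_degLE hG0 hG s).trans
    (Submodule.finrank_mono (degLE_le_of_forall_mem hwx _))

end Hypersurface

section Normalization

open MvPolynomial

variable {k L : Type*} [Field k] [Field L] [Algebra k L]

/-- The elements of degree at most `s` in `x` are, up to a fixed finite-dimensional factor, of
degree at most `s` in `z`. -/
def DegreeFinite (k : Type*) {L : Type*} [Field k] [Field L] [Algebra k L] {n r : ℕ}
    (x : Fin n → L) (z : Fin r → L) : Prop :=
  ∃ M : Submodule k L, M.FG ∧ ∀ s, degLE k x s ≤ M * degLE k z s

theorem DegreeFinite.refl {n : ℕ} (x : Fin n → L) : DegreeFinite k x x :=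
  ⟨1, ⟨{1}, by simp [Submodule.one_eq_span]⟩, fun s => by rw [one_mul]⟩

theorem DegreeFinite.trans {n r t : ℕ} {x : Fin n → L} {z : Fin r → L} {w : Fin t → L}
    (h1 : DegreeFinite k x z) (h2 : DegreeFinite k z w) : DegreeFinite k x w := by
  obtain ⟨M, hM, h⟩ := h1
  obtain ⟨M', hM', h'⟩ := h2
  refine ⟨M * M', hM.mul hM', fun s => (h s).trans ?_⟩
  rw [mul_assoc]
  exact mul_le_mul' le_rfl (h' s)

theorem finrank_mul_le (M N : Submodule k L) [Module.Finite k M] [Module.Finite k N] :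
    Module.finrank k (M * N : Submodule k L) ≤ Module.finrank k M * Module.finrank k N := by
  rw [← Module.finrank_tensorProduct, ← Submodule.mulMap_range]
  exact LinearMap.finrank_range_le _

theorem DegreeFinite.isAlgebraic {n r : ℕ} {x : Fin n → L} {z : Fin r → L}
    (h : DegreeFinite k x z) (hx : IntermediateField.adjoin k (Set.range x) = ⊤) :
    Algebra.IsAlgebraic (IntermediateField.adjoin k (Set.range z)) L := by
  obtain ⟨M, ⟨S, hS⟩, hM⟩ := h
  set F := IntermediateField.adjoin k (Set.range z) with hF
  have hzF : ∀ s, ∀ u ∈ degLE k z s, u ∈ F := by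
    intro s u hu
    obtain ⟨f, -, rfl⟩ := mem_degLE.1 hu
    have := IntermediateField.algebra_adjoin_le_adjoin k (Set.range z)
    exact this (by rw [Algebra.adjoin_range_eq_range_aeval]; exact ⟨f, rfl⟩)
  have hIntegral : ∀ i, IsIntegral F (x i) := by
    intro i
    refine IsIntegral.of_mem_of_fg (Algebra.adjoin F {x i}) ?_ _ (Algebra.subset_adjoin rfl)
    have hle : Subalgebra.toSubmodule (Algebra.adjoin F {x i}) ≤ Submodule.span F (S : Set L) := by
      rw [Algebra.adjoin_eq_span, Submodule.span_le]
      intro a ha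
      obtain ⟨s, rfl⟩ := Submonoid.mem_closure_singleton.1 ha
      have h1 : x i ^ s ∈ degLE k x s :=
        mem_degLE.2 ⟨X i ^ s, (totalDegree_X_pow i s).le, by simp⟩
      refine Submodule.mul_induction_on (hM s h1) (fun a ha u hu => ?_) fun a b => add_mem
      have h2 : a ∈ Submodule.span F (S : Set L) := by
        rw [← hS] at ha
        exact Submodule.span_le_restrictScalars k F _ ha
      rw [mul_comm]
      exact Submodule.smul_mem _ (⟨u, hzF s u hu⟩ : F) h2
    exact Submodule.FG.of_le (Submodule.fg_span S.finite_toSet) hle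
  have htop : (⊤ : IntermediateField k L) ≤ (algebraicClosure F L).restrictScalars k := by
    rw [← hx, IntermediateField.adjoin_le_iff]
    rintro _ ⟨i, rfl⟩
    exact mem_algebraicClosure_iff'.2 (hIntegral i)
  exact ⟨fun a => mem_algebraicClosure_iff.1 (htop (IntermediateField.mem_top (x := a)))⟩

theorem IntermediateField.isAlgebraic_algebra_adjoin {S : Set L}
    (h : Algebra.IsAlgebraic (IntermediateField.adjoin k S) L) :
    Algebra.IsAlgebraic (Algebra.adjoin k S) L := by
  open IntermediateField.algebraAdjoinAdjoin in
  exact (IsFractionRing.comap_isAlgebraic_iff (K := IntermediateField.adjoin k S)).2 h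

/-- Elimination of dependent elements, one at a time. -/
theorem exists_algebraicIndependent_of_step {Q : ∀ r : ℕ, (Fin r → L) → Prop} {n : ℕ}
    {x : Fin n → L} (h0 : Q n x)
    (hs : ∀ r (z : Fin (r + 1) → L), Q (r + 1) z → ¬ AlgebraicIndependent k z → ∃ z', Q r z') :
    ∃ r, ∃ z : Fin r → L, Q r z ∧ AlgebraicIndependent k z := by
  induction n with
  | zero => exact ⟨0, x, h0, algebraicIndependent_empty_type_iff.2 (algebraMap k L).injective⟩
  | succ n ih =>
    by_cases hx : AlgebraicIndependent k x
    · exact ⟨_, x, h0, hx⟩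
    · obtain ⟨z', hz'⟩ := hs n x h0 hx
      exact ih hz'

theorem intCombination_mem_degLE {n : ℕ} (x : Fin n → L) (ℓ : Fin n → ℤ) :
    ∑ i, (ℓ i : L) * x i ∈ degLE k x 1 := by
  refine Submodule.sum_mem _ fun i _ => ?_
  rw [← zsmul_eq_mul]
  exact zsmul_mem (apply_mem_degLE x i) _

variable {n m d : ℕ} {x : Fin n → L}

theorem card_le_of_algebraicIndependent
    (hh : Filter.Tendsto (fun s : ℕ => (Module.finrank k (degLE k x s) : ℝ) / s ^ m) Filter.atTop
      (nhds (d / m.factorial))) {r : ℕ} {z : Fin r → L} (hz : AlgebraicIndependent k z)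
    (hzx : ∀ i, z i ∈ degLE k x 1) : r ≤ m :=
  exponent_le_of_choose_le_hilbert hh fun s => by
    rw [← finrank_degLE_of_algebraicIndependent hz]
    exact Submodule.finrank_mono (degLE_le_of_forall_mem hzx s)

theorem DegreeFinite.le_card (hd : d ≠ 0)
    (hh : Filter.Tendsto (fun s : ℕ => (Module.finrank k (degLE k x s) : ℝ) / s ^ m) Filter.atTop
      (nhds (d / m.factorial))) {r : ℕ} {z : Fin r → L} (hz : DegreeFinite k x z) : m ≤ r := by
  obtain ⟨M, hM, h⟩ := hz
  have := Module.Finite.iff_fg.2 hM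
  have hfin : ∀ s, Module.Finite k (M * degLE k z s : Submodule k L) := fun s =>
    Module.Finite.iff_fg.2 (hM.mul (Module.Finite.iff_fg.1 inferInstance))
  refine le_exponent_of_hilbert_le_choose hd hh (c := Module.finrank k M) fun s => ?_
  exact (Submodule.finrank_mono (h s)).trans ((finrank_mul_le _ _).trans
    (Nat.mul_le_mul_left _ (finrank_degLE_le _ _)))

theorem DegreeFinite.isTranscendenceBasis {r : ℕ} {z : Fin r → L}
    (h : DegreeFinite k x z) (hx : IntermediateField.adjoin k (Set.range x) = ⊤)
    (hz : AlgebraicIndependent k z) : IsTranscendenceBasis k z := by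
  rw [isTranscendenceBasis_iff_algebraicIndependent_isAlgebraic]
  exact ⟨hz, IntermediateField.isAlgebraic_algebra_adjoin (h.isAlgebraic hx)⟩

theorem exists_isTranscendenceBasis_fin [CharZero k] (hd : d ≠ 0)
    (hx : IntermediateField.adjoin k (Set.range x) = ⊤)
    (hh : Filter.Tendsto (fun s : ℕ => (Module.finrank k (degLE k x s) : ℝ) / s ^ m) Filter.atTop
      (nhds (d / m.factorial))) : ∃ y : Fin m → L, IsTranscendenceBasis k y := by
  obtain ⟨r, z, ⟨hz1, hz2⟩, hz3⟩ := exists_algebraicIndependent_of_step (k := k) (x := x)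
    (Q := fun r z => DegreeFinite k x z ∧ ∀ i, z i ∈ degLE k x 1)
    ⟨.refl x, fun i => apply_mem_degLE x i⟩ (by
      rintro r z ⟨h1, h2⟩ h3
      rw [algebraicIndependent_iff] at h3
      push Not at h3
      obtain ⟨G, hG, hG0⟩ := h3
      obtain ⟨c, j, M, -, hM, h⟩ := exists_noether_step z hG0 hG le_rfl
      refine ⟨_, h1.trans ⟨M, hM, h⟩, fun i => ?_⟩
      simp only [← nsmul_eq_mul]
      exact sub_mem (nsmul_mem (h2 _) _) (nsmul_mem (h2 _) _))
  obtain rfl : r = m := le_antisymm (card_le_of_algebraicIndependent hh hz3 hz2) (hz1.le_card hd hh)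
  exact ⟨z, hz1.isTranscendenceBasis hx hz3⟩

theorem exists_relation_of_degreeFinite [CharZero k] (hd : d ≠ 0)
    (hx : IntermediateField.adjoin k (Set.range x) = ⊤)
    (hh : Filter.Tendsto (fun s : ℕ => (Module.finrank k (degLE k x s) : ℝ) / s ^ m) Filter.atTop
      (nhds (d / m.factorial))) {r : ℕ} {z : Fin r → L} (hz : DegreeFinite k x z)
    (hzx : ∀ i, z i ∈ degLE k x 1) (hdep : ¬ AlgebraicIndependent k z) :
    ∃ G : MvPolynomial (Fin r) k, G ≠ 0 ∧ aeval z G = 0 ∧ G.totalDegree ≤ d := by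
  have := IntermediateField.isAlgebraic_algebra_adjoin (hz.isAlgebraic hx)
  obtain ⟨t, htz, ht⟩ := exists_isTranscendenceBasis_subset (R := k) (Set.range z)
  obtain ⟨y, hy⟩ := exists_isTranscendenceBasis_fin hd hx hh
  have hcard := ht.lift_cardinalMk_eq hy
  obtain ⟨e⟩ := Cardinal.lift_mk_eq'.1 hcard
  choose σ hσ using fun i : Fin m => htz (e.symm i).2
  have hind : AlgebraicIndependent k fun i => z (σ i) := by
    simp only [hσ]
    exact ht.1.comp _ e.symm.injective
  have hσinj : Function.Injective σ := fun i j hij => hind.injective (by simp only [hij])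
  obtain ⟨i0, hi0⟩ : ∃ i0, i0 ∉ Set.range σ := by
    by_contra! hsurj
    refine hdep ?_
    have := hind.comp _ (Equiv.ofBijective σ ⟨hσinj, hsurj⟩).symm.injective
    convert! this using 1
    ext i
    exact congrArg z ((Equiv.ofBijective σ ⟨hσinj, hsurj⟩).apply_symm_apply i).symm
  let τ : Fin (m + 1) → Fin r := Fin.cons i0 σ
  have hτ : Function.Injective τ := Fin.cons_injective_iff.2 ⟨hi0, hσinj⟩
  obtain ⟨G, hG0, hG, hGd⟩ := exists_relation_totalDegree_le hh (w := fun i => z (τ i))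
    (fun i => hzx _) hind fun h => by
      have := card_le_of_algebraicIndependent hh h fun i => hzx _
      omega
  refine ⟨rename τ G, ?_, ?_, (totalDegree_rename_le _ _).trans hGd⟩
  · rwa [Ne, map_eq_zero_iff _ (rename_injective _ hτ)]
  · rw [aeval_rename]
    exact hG

/-- Effective Noether normalization. -/
theorem exists_noether_normalization [CharZero k] (hd : d ≠ 0)
    (hx : IntermediateField.adjoin k (Set.range x) = ⊤)
    (hh : Filter.Tendsto (fun s : ℕ => (Module.finrank k (degLE k x s) : ℝ) / s ^ m) Filter.atTop
      (nhds (d / m.factorial))) :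
    ∃ ℓ : Fin m → Fin n → ℤ, (∀ j i, |ℓ j i| ≤ (2 * d) ^ n) ∧
      AlgebraicIndependent k (fun j => ∑ i, (ℓ j i : L) * x i) ∧
      DegreeFinite k x (fun j => ∑ i, (ℓ j i : L) * x i) := by
  obtain ⟨r, z, ⟨hz1, hz2, ℓ, hℓ, hz⟩, hz3⟩ := exists_algebraicIndependent_of_step (k := k) (x := x)
    (Q := fun r z => DegreeFinite k x z ∧ r ≤ n ∧ ∃ ℓ : Fin r → Fin n → ℤ,
      (∀ j i, |ℓ j i| ≤ (2 * d) ^ (n - r)) ∧ ∀ j, z j = ∑ i, (ℓ j i : L) * x i)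
    ⟨.refl x, le_rfl, fun j i => if i = j then 1 else 0, fun j i => by
      dsimp only; split_ifs <;> simp, fun j => by simp⟩ (by
      rintro r z ⟨h1, hr, ℓ, hℓ, hz⟩ h3
      obtain ⟨G, hG0, hG, hGd⟩ := exists_relation_of_degreeFinite hd hx hh h1
        (fun i => hz i ▸ intCombination_mem_degLE _ _) h3
      obtain ⟨c, j, M, hc, hM, h⟩ := exists_noether_step z hG0 hG hGd
      refine ⟨_, h1.trans ⟨M, hM, h⟩, by omega,
        fun a i => c j * ℓ (j.succAbove a) i - c (j.succAbove a) * ℓ j i, fun a i => ?_,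
        fun a => ?_⟩
      · have hc' : ∀ i, |(c i : ℤ)| ≤ d := fun i => by
          rw [Nat.abs_cast]; exact_mod_cast hc i
        calc |(c j * ℓ (j.succAbove a) i - c (j.succAbove a) * ℓ j i : ℤ)|
            ≤ |(c j : ℤ)| * |ℓ (j.succAbove a) i| + |(c (j.succAbove a) : ℤ)| * |ℓ j i| := by
              rw [← abs_mul, ← abs_mul]; exact abs_sub _ _
          _ ≤ d * (2 * d) ^ (n - (r + 1)) + d * (2 * d) ^ (n - (r + 1)) := by
              gcongr <;> apply_assumption
          _ = (2 * d) ^ (n - r) := by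
              rw [show n - r = n - (r + 1) + 1 by omega, pow_succ]; ring
      · simp only [hz, Finset.mul_sum, ← Finset.sum_sub_distrib]
        refine Finset.sum_congr rfl fun i _ => ?_
        push_cast
        ring)
  obtain rfl : r = m := le_antisymm (card_le_of_algebraicIndependent hh hz3
    fun i => hz i ▸ intCombination_mem_degLE _ _) (hz1.le_card hd hh)
  obtain rfl : z = fun j => ∑ i, (ℓ j i : L) * x i := funext hz
  refine ⟨ℓ, fun j i => (hℓ j i).trans ?_, hz3, hz1⟩
  exact pow_le_pow_right₀ (by have := Nat.pos_of_ne_zero hd; omega) (Nat.sub_le _ _)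

end Normalization

section PrimitiveElement

open MvPolynomial

open IntermediateField in
theorem exists_primitive_combination {F L : Type*} [Field F] [CharZero F] [Field L] [Algebra F L]
    [FiniteDimensional F L] {n : ℕ} {x : Fin n → L} (hx : adjoin F (Set.range x) = ⊤) :
    ∃ t : ℕ, t ≤ Module.finrank F L ^ 2 * n ∧ F⟮∑ i : Fin n, (t : L) ^ (i : ℕ) * x i⟯ = ⊤ := by
  classical
  let Ω := AlgebraicClosure L
  let q : (L →ₐ[F] Ω) → (L →ₐ[F] Ω) → Polynomial Ω := fun σ τ =>
    ∑ i : Fin n, Polynomial.C (σ (x i) - τ (x i)) * Polynomial.X ^ (i : ℕ)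
  have hq0 : ∀ σ τ, σ ≠ τ → q σ τ ≠ 0 := by
    intro σ τ hne h0
    refine hne ?_
    have h1 : ∀ i, σ (x i) = τ (x i) := by
      intro i
      have := congrArg (fun p => Polynomial.coeff p (i : ℕ)) h0
      simp only [q, Polynomial.finsetSum_coeff, Polynomial.coeff_C_mul, Polynomial.coeff_X_pow,
        Fin.val_inj, mul_ite, mul_one, mul_zero, Polynomial.coeff_zero, Finset.sum_ite_eq,
        Finset.mem_univ, if_true] at this
      exact sub_eq_zero.1 this
    have h2 := algHom_ext_of_eq_adjoin F hx.symm (φ₁ := σ.comp (⊤ : IntermediateField F L).val)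
      (φ₂ := τ.comp (⊤ : IntermediateField F L).val) (by rintro _ ⟨i, rfl⟩; exact h1 i)
    ext a
    exact DFunLike.congr_fun h2 ⟨a, mem_top⟩
  have hqdeg : ∀ σ τ, (q σ τ).natDegree ≤ n := fun σ τ =>
    Polynomial.natDegree_sum_le_of_forall_le _ _ fun i _ =>
      (Polynomial.natDegree_C_mul_X_pow_le _ _).trans i.2.le
  let p : Polynomial Ω := ∏ στ ∈ (Finset.univ : Finset (L →ₐ[F] Ω)).offDiag, q στ.1 στ.2
  have hp0 : p ≠ 0 := Finset.prod_ne_zero_iff.2 fun στ h => hq0 _ _ (Finset.mem_offDiag.1 h).2.2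
  have hpdeg : p.natDegree ≤ Module.finrank F L ^ 2 * n := by
    refine (Polynomial.natDegree_prod_le _ _).trans ((Finset.sum_le_sum fun στ _ =>
      hqdeg _ _).trans ?_)
    rw [Finset.sum_const, smul_eq_mul]
    refine Nat.mul_le_mul_right _ ?_
    rw [Finset.offDiag_card, Finset.card_univ, AlgHom.card F L Ω, sq]
    exact Nat.sub_le _ _
  obtain ⟨t, ht, htp⟩ : ∃ t ≤ Module.finrank F L ^ 2 * n, p.eval (t : Ω) ≠ 0 := by
    by_contra! H
    refine hp0 (Polynomial.eq_zero_of_natDegree_lt_card_of_eval_eq_zero' p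
      ((Finset.range (Module.finrank F L ^ 2 * n + 1)).map ⟨Nat.cast, ?_⟩) ?_ ?_)
    · have : CharZero Ω := charZero_of_injective_algebraMap (algebraMap F Ω).injective
      exact Nat.cast_injective
    · intro a ha
      obtain ⟨t, ht, rfl⟩ := Finset.mem_map.1 ha
      exact H t (Nat.lt_succ_iff.1 (Finset.mem_range.1 ht))
    · rw [Finset.card_map, Finset.card_range]
      exact Nat.lt_succ_of_le hpdeg
  refine ⟨t, ht, (Field.primitive_element_iff_algHom_eq_of_eval' F Ω
    (fun _ => IsAlgClosed.splits _) _).2 fun σ τ hστ => ?_⟩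
  by_contra hne
  rw [Polynomial.eval_prod] at htp
  refine Finset.prod_ne_zero_iff.1 htp (σ, τ) (by simpa using hne) ?_
  have : ∑ i : Fin n, ((t : Ω) ^ (i : ℕ) * σ (x i)) = ∑ i : Fin n, ((t : Ω) ^ (i : ℕ) * τ (x i)) := by
    simpa using hστ
  simp only [q, Polynomial.eval_finsetSum, Polynomial.eval_mul, Polynomial.eval_C,
    Polynomial.eval_pow, Polynomial.eval_X, sub_mul, Finset.sum_sub_distrib]
  rw [sub_eq_zero]
  simpa only [mul_comm] using this

variable {k L : Type*} [Field k] [Field L] [Algebra k L] {n m d : ℕ}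

open IntermediateField in
theorem finrank_le_degreeOf_zero {w : Fin (m + 1) → L}
    (hy : AlgebraicIndependent k fun i : Fin m => w i.succ)
    [FiniteDimensional (adjoin k (Set.range fun i : Fin m => w i.succ)) L]
    (hw : (adjoin k (Set.range fun i : Fin m => w i.succ))⟮w 0⟯ = ⊤)
    {f : MvPolynomial (Fin (m + 1)) k} (hf : f ≠ 0) (hfw : aeval w f = 0) :
    Module.finrank (adjoin k (Set.range fun i : Fin m => w i.succ)) L ≤ degreeOf 0 f := by
  set F := adjoin k (Set.range fun i : Fin m => w i.succ) with hF
  let y : Fin m → F := fun i => ⟨w i.succ, subset_adjoin _ _ ⟨i, rfl⟩⟩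
  let φ : MvPolynomial (Fin m) k →ₐ[k] F := aeval y
  have hφ : (F.val.comp φ) = aeval fun i : Fin m => w i.succ := by
    ext i
    simp [φ, y]
  have hφinj : Function.Injective φ := by
    refine Function.Injective.of_comp (f := F.val) ?_
    rw [← AlgHom.coe_comp, hφ]
    exact hy
  let q : Polynomial F := (finSuccEquiv k m f).map φ.toRingHom
  have hq0 : q ≠ 0 := by
    rw [Ne, Polynomial.map_eq_zero_iff hφinj]
    simpa using hf
  have hqw : Polynomial.aeval (w 0) q = 0 := by
    rw [← hfw, aeval_eq_polynomial_aeval_finSuccEquiv, Polynomial.aeval_def, Polynomial.eval₂_map,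
      ← hφ]
    rfl
  rw [← (Field.primitive_element_iff_minpoly_natDegree_eq F (w 0)).1 hw, ← natDegree_finSuccEquiv]
  exact (Polynomial.natDegree_le_natDegree (minpoly.degree_le_of_ne_zero F (w 0) hq0 hqw)).trans
    Polynomial.natDegree_map_le

open IntermediateField in
theorem exists_common_denominator {y : Fin m → L} (T : Finset L)
    (hT : ∀ a ∈ T, a ∈ adjoin k (Set.range y)) :
    ∃ q : L, ∃ c : ℕ, q ≠ 0 ∧ q ∈ degLE k y c ∧ ∀ a ∈ T, q * a ∈ degLE k y c := by
  classical
  induction T using Finset.induction_on with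
  | empty => exact ⟨1, 0, one_ne_zero, one_mem_degLE _ _, by simp⟩
  | insert a T _ ih =>
    obtain ⟨q, c, hq, hqc, h⟩ := ih fun b hb => hT b (Finset.mem_insert_of_mem hb)
    obtain ⟨u, v, huv⟩ := (mem_adjoin_range_iff k y a).1 (hT a (Finset.mem_insert_self _ _))
    obtain ⟨p, b, hp, hpb, hpa⟩ : ∃ p : L, ∃ b : ℕ, p ≠ 0 ∧ p ∈ degLE k y b ∧
        p * a ∈ degLE k y b := by
      by_cases hv : aeval y v = 0
      · exact ⟨1, 0, one_ne_zero, one_mem_degLE _ _, by rw [huv, hv]; simp⟩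
      · refine ⟨aeval y v, max u.totalDegree v.totalDegree, hv,
          mem_degLE.2 ⟨v, le_max_right _ _, rfl⟩, ?_⟩
        rw [huv, mul_div_cancel₀ _ hv]
        exact mem_degLE.2 ⟨u, le_max_left _ _, rfl⟩
    refine ⟨q * p, c + b, mul_ne_zero hq hp, mul_mem_degLE hqc hpb, fun a' ha' => ?_⟩
    rcases Finset.mem_insert.1 ha' with rfl | ha'
    · rw [mul_assoc]
      exact mul_mem_degLE hqc hpa
    · rw [mul_right_comm]
      exact mul_mem_degLE (h _ ha') hpb

/-- The sums `∑ i < e, t ^ i * u i` with `u i` of degree at most `c` in `y`. -/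
noncomputable def powSumMap (k : Type*) {L : Type*} [Field k] [Field L] [Algebra k L] {m : ℕ}
    (t : L) (y : Fin m → L) (e c : ℕ) : (Fin e → degLE k y c) →ₗ[k] L :=
  ∑ i : Fin e, (LinearMap.mulLeft k (t ^ (i : ℕ))).comp
    ((degLE k y c).subtype.comp (LinearMap.proj i))

theorem mem_range_powSumMap {t : L} {y : Fin m → L} {e c : ℕ} {a : L} :
    a ∈ LinearMap.range (powSumMap k t y e c) ↔
      ∃ u : Fin e → L, (∀ i, u i ∈ degLE k y c) ∧ a = ∑ i : Fin e, t ^ (i : ℕ) * u i := by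
  constructor
  · rintro ⟨u, rfl⟩
    exact ⟨fun i => u i, fun i => (u i).2, by simp [powSumMap]⟩
  · rintro ⟨u, hu, rfl⟩
    exact ⟨fun i => ⟨u i, hu i⟩, by simp [powSumMap]⟩

theorem finrank_range_powSumMap_le (t : L) (y : Fin m → L) (e c : ℕ) :
    Module.finrank k (LinearMap.range (powSumMap k t y e c)) ≤ e * (c + m).choose m := by
  refine (LinearMap.finrank_range_le _).trans ?_
  rw [Module.finrank_pi_fintype]
  simpa using Nat.mul_le_mul_left e (finrank_degLE_le y c)

open IntermediateField in
theorem exists_eq_sum_pow_mul {F L : Type*} [Field F] [Field L] [Algebra F L]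
    [FiniteDimensional F L] {t : L} (ht : F⟮t⟯ = ⊤) (a : L) :
    ∃ u : Fin (Module.finrank F L) → F,
      a = ∑ i : Fin (Module.finrank F L), t ^ (i : ℕ) * algebraMap F L (u i) := by
  have h1 : a ∈ F⟮t⟯.toSubalgebra := by rw [ht]; trivial
  rw [adjoin_simple_toSubalgebra_of_isAlgebraic (Algebra.IsAlgebraic.isAlgebraic t),
    Algebra.adjoin_singleton_eq_range_aeval] at h1
  obtain ⟨p, rfl⟩ := h1
  have hIntegral : IsIntegral F t := Algebra.IsIntegral.isIntegral t
  have hdeg : (p %ₘ minpoly F t).natDegree < Module.finrank F L := by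
    rw [← (Field.primitive_element_iff_minpoly_natDegree_eq F t).1 ht]
    exact Polynomial.natDegree_modByMonic_lt _ (minpoly.monic hIntegral) (minpoly.ne_one F t)
  refine ⟨fun i => (p %ₘ minpoly F t).coeff i, ?_⟩
  change Polynomial.aeval t p = _
  rw [← minpoly.aeval_modByMonic_minpoly, Polynomial.aeval_eq_sum_range' hdeg, Finset.sum_range]
  exact Finset.sum_congr rfl fun i _ => by rw [Algebra.smul_def, mul_comm]

open IntermediateField in
theorem le_finrank_of_degreeFinite {x : Fin n → L}
    (hh : Filter.Tendsto (fun s : ℕ => (Module.finrank k (degLE k x s) : ℝ) / s ^ m) Filter.atTop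
      (nhds (d / m.factorial))) {y : Fin m → L} (hxy : DegreeFinite k x y) {t : L}
    [FiniteDimensional (adjoin k (Set.range y)) L]
    (ht : (adjoin k (Set.range y))⟮t⟯ = ⊤) :
    d ≤ Module.finrank (adjoin k (Set.range y)) L := by
  classical
  set F := adjoin k (Set.range y) with hF
  set e := Module.finrank F L
  obtain ⟨M, ⟨S, hS⟩, hM⟩ := hxy
  choose u hu using exists_eq_sum_pow_mul ht
  obtain ⟨q, c, hq, -, hqT⟩ := exists_common_denominator (k := k) (y := y)
    ((S ×ˢ (Finset.univ : Finset (Fin e))).image fun p => (u p.1 p.2 : L)) (by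
      intro a ha
      obtain ⟨p, -, rfl⟩ := Finset.mem_image.1 ha
      exact (u p.1 p.2).2)
  have hle : ∀ s, ∀ a ∈ degLE k x s, q * a ∈ LinearMap.range (powSumMap k t y e (s + c)) := by
    intro s a ha
    refine Submodule.mul_induction_on (hM s ha) (fun a ha b hb => ?_) fun a b ha hb => by
      rw [mul_add]; exact add_mem ha hb
    rw [← hS] at ha
    induction ha using Submodule.span_induction with
    | mem a ha =>
      refine mem_range_powSumMap.2 ⟨fun i => q * u a i * b, fun i => ?_, ?_⟩
      · rw [add_comm]
        exact mul_mem_degLE (hqT _ (Finset.mem_image.2 ⟨(a, i), by simpa using ha, rfl⟩)) hb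
      · conv_lhs => rw [hu a]
        rw [Finset.sum_mul, Finset.mul_sum]
        refine Finset.sum_congr rfl fun i _ => ?_
        rw [IntermediateField.algebraMap_apply]
        ring
    | zero => simp
    | add a a' _ _ h1 h2 => rw [add_mul, mul_add]; exact add_mem h1 h2
    | smul c a _ h => rw [smul_mul_assoc, mul_smul_comm]; exact Submodule.smul_mem _ _ h
  refine le_of_hilbert_le_choose hh (c := c) fun s => ?_
  refine le_trans ?_ (finrank_range_powSumMap_le (k := k) t y e (s + c))
  have hinj : Function.Injective (LinearMap.mulLeft k q) := fun a b h => mul_left_cancel₀ hq h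
  rw [LinearEquiv.finrank_eq (Submodule.equivMapOfInjective _ hinj (degLE k x s))]
  refine Submodule.finrank_mono ?_
  rintro _ ⟨a, ha, rfl⟩
  exact hle s a ha

/-- A generic projection of a variety of dimension `m` and degree `d`, given by integer linear
forms of bounded size, is a hypersurface of degree `d` in both senses used below. -/
theorem exists_hypersurface_projection [CharZero k] (hd : d ≠ 0) {x : Fin n → L}
    (hx : IntermediateField.adjoin k (Set.range x) = ⊤)
    (hh : Filter.Tendsto (fun s : ℕ => (Module.finrank k (degLE k x s) : ℝ) / s ^ m) Filter.atTop
      (nhds (d / m.factorial))) :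
    ∃ ℓ : Fin (m + 1) → Fin n → ℤ, (∀ j i, |ℓ j i| ≤ (2 * d) ^ n + (d ^ 2 * n + 1) ^ n) ∧
      (∀ f : MvPolynomial (Fin (m + 1)) k, f ≠ 0 → degreeOf 0 f < d →
        aeval (fun j => ∑ i, (ℓ j i : L) * x i) f ≠ 0) ∧
      ∃ f : MvPolynomial (Fin (m + 1)) k, f ≠ 0 ∧ f.totalDegree ≤ d ∧
        aeval (fun j => ∑ i, (ℓ j i : L) * x i) f = 0 := by
  obtain ⟨ℓ, hℓ, hind, hfin⟩ := exists_noether_normalization hd hx hh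
  set y : Fin m → L := fun j => ∑ i, (ℓ j i : L) * x i with hy
  set F := IntermediateField.adjoin k (Set.range y) with hF
  have halg := hfin.isAlgebraic hx
  have hxF : IntermediateField.adjoin F (Set.range x) = ⊤ := by
    rw [eq_top_iff, ← IntermediateField.restrictScalars_le_iff k, IntermediateField.restrictScalars_top, ← hx,
      IntermediateField.adjoin_le_iff]
    exact IntermediateField.subset_adjoin F (Set.range x)
  have : FiniteDimensional F L := by
    have := IntermediateField.finiteDimensional_adjoin (K := F) (S := Set.range x)
      fun a _ => (halg.isAlgebraic a).isIntegral
    rw [hxF] at this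
    exact IntermediateField.topEquiv.toLinearEquiv.finiteDimensional
  obtain ⟨t, ht, htop⟩ := exists_primitive_combination hxF
  let ℓ' : Fin (m + 1) → Fin n → ℤ := Fin.cons (fun i => (t : ℤ) ^ (i : ℕ)) ℓ
  set w : Fin (m + 1) → L := fun j => ∑ i, (ℓ' j i : L) * x i with hw
  have hwsucc : (fun i : Fin m => w i.succ) = y := by
    ext j; simp [hw, ℓ', hy]
  have hw0 : w 0 = ∑ i : Fin n, (t : L) ^ (i : ℕ) * x i := by
    simp [hw, ℓ']
  have hwx : ∀ i, w i ∈ degLE k x 1 := fun i => intCombination_mem_degLE _ _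
  obtain ⟨G, hG0, hG, hGd⟩ := exists_relation_totalDegree_le hh hwx (by rwa [hwsucc]) fun h => by
    have := card_le_of_algebraicIndependent hh h hwx
    omega
  have key : ∀ f : MvPolynomial (Fin (m + 1)) k, f ≠ 0 → aeval w f = 0 →
      Module.finrank F L ≤ degreeOf 0 f := by
    intro f hf hfw
    have := finrank_le_degreeOf_zero (k := k) (w := w)
    rw [hwsucc, hw0] at this
    exact this hind htop hf hfw
  have he : Module.finrank F L ≤ d :=
    (key G hG0 hG).trans ((degreeOf_le_totalDegree _ _).trans hGd)
  have hde : d ≤ Module.finrank F L := le_finrank_of_degreeFinite hh hfin htop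
  refine ⟨ℓ', fun j i => ?_, fun f hf hfd hfw => ?_, G, hG0, hGd, hG⟩
  · refine Fin.cases ?_ (fun j => ?_) j
    · simp only [ℓ', Fin.cons_zero, abs_pow, Nat.abs_cast]
      have h1 : (t : ℤ) ^ (i : ℕ) ≤ (d ^ 2 * n + 1) ^ n := by
        have h2 : t ≤ d ^ 2 * n + 1 := ht.trans
          (le_trans (Nat.mul_le_mul_right _ (Nat.pow_le_pow_left he 2)) (Nat.le_succ _))
        exact_mod_cast (Nat.pow_le_pow_left h2 _).trans
          (Nat.pow_le_pow_right (Nat.succ_pos _) i.2.le)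
      have : (0 : ℤ) ≤ (2 * d) ^ n := by positivity
      linarith
    · simp only [ℓ', Fin.cons_succ]
      have : (0 : ℤ) ≤ (d ^ 2 * n + 1) ^ n := by positivity
      linarith [hℓ j i]
  · have := key f hf hfw
    omega

end PrimitiveElement

section Determinants

theorem pow_dvd_det_of_forall_injective {ι κ : Type*} [Fintype ι] [DecidableEq ι] [Fintype κ]
    {q : ℤ} {w : κ → ℕ} {E : ℕ} (hE : ∀ σ : ι → κ, Function.Injective σ → E ≤ ∑ i, w (σ i))
    {M : Matrix ι ι ℤ} (U : ι → κ → ℤ) (D : κ → ι → ℤ)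
    (hM : ∀ k i, M k i = ∑ j, U k j * q ^ w j * D j i) : q ^ E ∣ M.det := by
  have hrow : M = fun k => ∑ j, (U k j * q ^ w j) • D j := by
    ext k i
    simp [hM, Finset.sum_apply]
  have hdet : M.det = ∑ σ : ι → κ, Matrix.detRowAlternating fun k =>
      (U k (σ k) * q ^ w (σ k)) • D (σ k) := by
    conv_lhs => rw [hrow]
    exact MultilinearMap.map_sum (Matrix.detRowAlternating (n := ι) (R := ℤ)).toMultilinearMap _
  rw [hdet]
  refine Finset.dvd_sum fun σ _ => ?_
  rw [AlternatingMap.map_smul_univ, smul_eq_mul]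
  by_cases hσ : Function.Injective σ
  · refine Dvd.dvd.mul_right ?_ _
    rw [Finset.prod_mul_distrib, Finset.prod_pow_eq_pow_sum]
    exact (pow_dvd_pow q (hE σ hσ)).mul_left _
  · obtain ⟨i, j, hij, hne⟩ := Function.not_injective_iff.1 hσ
    rw [AlternatingMap.map_eq_zero_of_eq _ (fun k => D (σ k)) (by rw [hij]) hne, mul_zero]
    exact dvd_zero _

theorem abs_det_le_factorial_mul_prod {ι : Type*} [Fintype ι] [DecidableEq ι]
    {M : Matrix ι ι ℤ} {b : ι → ℤ} (hb : ∀ k i, |M k i| ≤ b i) :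
    |M.det| ≤ (Fintype.card ι).factorial * ∏ i, b i := by
  rw [Matrix.det_apply]
  refine (Finset.abs_sum_le_sum_abs _ _).trans ?_
  refine (Finset.sum_le_card_nsmul _ _ (∏ i, b i) fun σ _ => ?_).trans ?_
  · rw [Units.smul_def, smul_eq_mul, abs_mul, Int.isUnit_iff_abs_eq.1 (Units.isUnit _), one_mul,
      Finset.abs_prod]
    exact Finset.prod_le_prod (fun _ _ => abs_nonneg _) fun i _ => hb _ _
  · rw [Finset.card_univ, Fintype.card_perm, nsmul_eq_mul]

attribute [local instance] Matrix.seminormedAddCommGroup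

/-- A family of integer vectors of bounded size all of whose maximal minors vanish is annihilated by
a nonzero integer vector of bounded size. -/
theorem exists_int_relation {ι P : Type*} [Fintype ι] [DecidableEq ι] (F : P → ι → ℤ) {A : ℕ}
    (hA : 1 ≤ A) (hF : ∀ p i, |F p i| ≤ A)
    (hdet : ∀ s : ι → P, (Matrix.of fun k i => F (s k) i).det = 0) :
    ∃ c : ι → ℤ, c ≠ 0 ∧ (∀ i, |c i| ≤ ((Fintype.card ι * A) ^ Fintype.card ι : ℕ)) ∧
      ∀ p, ∑ i, F p i * c i = 0 := by
  classical
  let v : P → ι → ℚ := fun p i => F p i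
  obtain ⟨r, hr⟩ : ∃ r, Module.finrank ℚ (Submodule.span ℚ (Set.range v)) = r := ⟨_, rfl⟩
  have hbasis := Submodule.exists_fun_fin_finrank_span_eq ℚ (Set.range v)
  rw [hr] at hbasis
  obtain ⟨f, hf, hspan, hli⟩ := hbasis
  choose s hs using hf
  have hrN : r ≤ Fintype.card ι := by
    simpa [hr] using Submodule.finrank_le (Submodule.span ℚ (Set.range v))
  have hlt : r < Fintype.card ι := by
    refine lt_of_le_of_ne hrN fun h => ?_
    let e : ι ≃ Fin r := Fintype.equivFinOfCardEq h.symm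
    have h1 := hdet fun k => s (e k)
    have h2 : LinearIndependent ℚ (Matrix.of fun k i => v (s (e k)) i).row := by
      have := hli.comp e e.injective
      rwa [show f ∘ e = (Matrix.of fun k i => v (s (e k)) i).row by
        ext k i; simp [Matrix.row, hs]] at this
    rw [Matrix.linearIndependent_rows_iff_isUnit, Matrix.isUnit_iff_isUnit_det,
      isUnit_iff_ne_zero] at h2
    refine h2 ?_
    have h3 : (Matrix.of fun k i => v (s (e k)) i) =
        (Matrix.of fun k i => F (s (e k)) i).map (Int.castRingHom ℚ) := by
      ext; simp [v]
    rw [h3, ← RingHom.mapMatrix_apply, ← RingHom.map_det, h1, map_zero]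
  obtain ⟨c, hc0, hcs, hcb⟩ : ∃ c : ι → ℤ, c ≠ 0 ∧ (∀ k, ∑ i, F (s k) i * c i = 0) ∧
      ∀ i, |c i| ≤ ((Fintype.card ι * A) ^ Fintype.card ι : ℕ) := by
    rcases Nat.eq_zero_or_pos r with h0 | h0
    · have : Nonempty ι := Fintype.card_pos_iff.1 (by omega)
      refine ⟨1, one_ne_zero, fun k => absurd k.2 (by omega), fun i => ?_⟩
      have : 1 ≤ (Fintype.card ι * A) ^ Fintype.card ι :=
        Nat.one_le_pow _ _ (Nat.mul_pos Fintype.card_pos hA)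
      rw [Pi.one_apply, abs_one]
      exact_mod_cast this
    · let M : Matrix (Fin r) ι ℤ := Matrix.of fun k i => F (s k) i
      obtain ⟨c, hc0, hc, hcb⟩ := Int.Matrix.exists_ne_zero_int_vec_norm_le M (by simpa using hlt)
        (by simpa using h0)
      refine ⟨c, hc0, fun k => congrFun hc k, fun i => ?_⟩
      have hMA : max 1 ‖M‖ ≤ A := by
        refine max_le (by exact_mod_cast hA) ((Matrix.norm_le_iff (by positivity)).2 fun k i => ?_)
        rw [Int.norm_eq_abs]
        exact_mod_cast hF _ _
      have h1 : (|c i| : ℝ) ≤ (Fintype.card ι * A) ^ Fintype.card ι := by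
        rw [← Int.norm_eq_abs]
        refine (norm_le_pi_norm c i).trans (hcb.trans ?_)
        have hN : (1 : ℝ) ≤ Fintype.card ι := by exact_mod_cast (by omega : 1 ≤ Fintype.card ι)
        have hb : (Fintype.card ι * max 1 ‖M‖ : ℝ) ≤ Fintype.card ι * A := by gcongr
        have hb1 : (1 : ℝ) ≤ Fintype.card ι * max 1 ‖M‖ :=
          one_le_mul_of_one_le_of_one_le hN (le_max_left _ _)
        refine (Real.rpow_le_rpow_of_exponent_le hb1 (z := Fintype.card ι) ?_).trans ?_
        · have h3 : (1 : ℝ) ≤ (Fintype.card ι : ℝ) - r := by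
            have : (r + 1 : ℝ) ≤ Fintype.card ι := by exact_mod_cast hlt
            linarith
          rw [Fintype.card_fin, div_le_iff₀ (by linarith)]
          have : (r : ℝ) ≤ Fintype.card ι := by exact_mod_cast hrN
          nlinarith
        · rw [Real.rpow_natCast]
          gcongr
      exact_mod_cast h1
  refine ⟨c, hc0, hcb, fun p => ?_⟩
  let φ : (ι → ℚ) →ₗ[ℚ] ℚ := ∑ i, (c i : ℚ) • LinearMap.proj i
  have hφ : ∀ p, φ (v p) = ((∑ i, F p i * c i : ℤ) : ℚ) := by
    intro p
    simp [φ, v, mul_comm]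
  have hle : Submodule.span ℚ (Set.range v) ≤ LinearMap.ker φ := by
    rw [← hspan, Submodule.span_le]
    rintro _ ⟨k, rfl⟩
    rw [SetLike.mem_coe, LinearMap.mem_ker, ← hs k, hφ, hcs, Int.cast_zero]
  have := hle (Submodule.subset_span ⟨p, rfl⟩)
  rw [LinearMap.mem_ker, hφ] at this
  exact_mod_cast this

end Determinants

section Congruences

open MvPolynomial

theorem MvPolynomial.finSuccEquiv_pderiv_zero {R : Type*} [CommSemiring R] {m : ℕ}
    (f : MvPolynomial (Fin (m + 1)) R) :
    finSuccEquiv R m (pderiv 0 f) = Polynomial.derivative (finSuccEquiv R m f) := by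
  induction f using MvPolynomial.induction_on with
  | C a => simp [finSuccEquiv_apply]
  | add f g hf hg => simp [hf, hg]
  | mul_X f i hf =>
    refine Fin.cases ?_ (fun i => ?_) i
    · simp [hf, pderiv_X, finSuccEquiv_X_zero, mul_comm]
    · simp [hf, pderiv_X, finSuccEquiv_X_succ, mul_comm]

theorem MvPolynomial.eval_eq_eval_finSuccEquiv {R : Type*} [CommSemiring R] {m : ℕ}
    (f : MvPolynomial (Fin (m + 1)) R) (x : Fin (m + 1) → R) :
    eval x f = ((finSuccEquiv R m f).map (eval (Fin.tail x))).eval (x 0) := by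
  rw [← eval_eq_eval_mv_eval', Fin.cons_self_tail]

theorem MvPolynomial.dvd_eval_sub_eval {σ : Type*} (f : MvPolynomial σ ℤ) {p : ℤ} {x y : σ → ℤ}
    (h : ∀ i, p ∣ x i - y i) : p ∣ eval x f - eval y f := by
  induction f using MvPolynomial.induction_on with
  | C a => simp
  | add f g hf hg =>
    rw [map_add, map_add, add_sub_add_comm]
    exact dvd_add hf hg
  | mul_X f i hf =>
    rw [map_mul, map_mul, eval_X, eval_X]
    have : eval x f * x i - eval y f * y i =
      (eval x f - eval y f) * x i + eval y f * (x i - y i) := by ring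
    rw [this]
    exact dvd_add (hf.mul_right _) ((h i).mul_left _)

/-- Hensel's lemma with parameters: near a point where the derivative in the first variable is a unit
modulo `p`, the first coordinate of a zero is a polynomial in the others modulo powers of `p`. -/
theorem exists_local_parametrization {m : ℕ} (G : MvPolynomial (Fin (m + 1)) ℤ) {p : ℤ}
    {x₀ : Fin (m + 1) → ℤ} (hcop : IsCoprime (eval x₀ (pderiv 0 G)) p) (k : ℕ) :
    ∃ φ : MvPolynomial (Fin m) ℤ, ∀ x : Fin (m + 1) → ℤ, eval x G = 0 →
      (∀ i, p ∣ x i - x₀ i) → p ^ (k + 1) ∣ x 0 - eval (Fin.tail x) φ := by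
  obtain ⟨u, v, huv⟩ := hcop
  induction k with
  | zero => exact ⟨C (x₀ 0), fun x _ hx => by simpa using hx 0⟩
  | succ k ih =>
    obtain ⟨φ, hφ⟩ := ih
    refine ⟨φ - C u * (finSuccEquiv ℤ m G).eval φ, fun x hxG hx => ?_⟩
    set y := Fin.tail x with hy
    set g := (finSuccEquiv ℤ m G).map (eval y) with hg
    set δ := x 0 - eval y φ with hδ
    have h1 : eval y ((finSuccEquiv ℤ m G).eval φ) = g.eval (eval y φ) := by
      rw [hg, Polynomial.eval_map, Polynomial.eval₂_at_apply]
    obtain ⟨R, hR⟩ := g.binomExpansion (eval y φ) δ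
    have h2 : g.eval (eval y φ + δ) = 0 := by
      rw [hδ, add_sub_cancel, hg, hy, ← eval_eq_eval_finSuccEquiv, hxG]
    have hpδ : p ^ (k + 1) ∣ δ := hφ x hxG hx
    have hpδ' : p ∣ δ := (dvd_pow_self p k.succ_ne_zero).trans hpδ
    have h3 : p ∣ g.derivative.eval (eval y φ) - eval x₀ (pderiv 0 G) := by
      have h4 : g.derivative.eval (eval y φ) = eval (Fin.cons (eval y φ) y) (pderiv 0 G) := by
        rw [eval_eq_eval_mv_eval', finSuccEquiv_pderiv_zero, hg, Polynomial.derivative_map]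
      rw [h4]
      refine dvd_eval_sub_eval _ fun i => ?_
      refine Fin.cases ?_ (fun i => ?_) i
      · have := dvd_sub (hx 0) hpδ'
        rw [Fin.cons_zero]
        rwa [show x 0 - x₀ 0 - δ = eval y φ - x₀ 0 by rw [hδ]; ring] at this
      · exact hx i.succ
    rw [map_sub, map_mul, eval_C, h1]
    obtain ⟨c, hc⟩ := h3
    obtain ⟨e, he⟩ := hpδ'
    have h5 : x 0 - (eval y φ - u * g.eval (eval y φ)) = δ * (p * (v - u * c - u * R * e)) := by
      have h6 : g.eval (eval y φ) = - (g.derivative.eval (eval y φ) * δ + R * δ ^ 2) := by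
        linarith
      have h7 : g.derivative.eval (eval y φ) = eval x₀ (pderiv 0 G) + p * c := by linarith
      rw [h7] at h6
      have h8 : u * eval x₀ (pderiv 0 G) = 1 - v * p := by linarith
      have h9 : x 0 - (eval y φ - u * g.eval (eval y φ)) = δ + u * g.eval (eval y φ) := by
        rw [hδ]; ring
      rw [h9, h6]
      linear_combination (-δ) * h8 - u * R * δ * he
    rw [h5, pow_succ p (k + 1)]
    exact mul_dvd_mul hpδ (dvd_mul_right _ _)

theorem exists_local_expansion {m : ℕ} (Φ : MvPolynomial (Fin m) ℤ) (p : ℤ) (a : Fin m → ℤ)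
    (T : ℕ) : ∃ c : (Fin m →₀ ℕ) → ℤ, ∀ v : Fin m → ℤ,
      p ^ T ∣ eval (fun i => a i + p * v i) Φ -
        ∑ α ∈ expLE m T, (∏ i, v i ^ α i) * p ^ α.degree * c α := by
  classical
  let Ψ : MvPolynomial (Fin m) ℤ := aeval (fun i => C (a i) + X i) Φ
  refine ⟨fun α => coeff α Ψ, fun v => ?_⟩
  have h1 : eval (fun i => a i + p * v i) Φ =
      ∑ α ∈ Ψ.support, (∏ i, v i ^ α i) * p ^ α.degree * coeff α Ψ := by
    have : eval (fun i => a i + p * v i) Φ = eval (fun i => p * v i) Ψ := by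
      simp only [Ψ, aeval_def, algebraMap_eq, ← coe_eval₂Hom, ← RingHom.comp_apply]
      congr 1
      ext i <;> simp
    rw [this, eval_eq']
    refine Finset.sum_congr rfl fun α _ => ?_
    simp only [mul_pow, Finset.prod_mul_distrib, Finset.prod_pow_eq_pow_sum, Finsupp.degree_eq_sum]
    ring
  have h2 : ∑ α ∈ expLE m T, (∏ i, v i ^ α i) * p ^ α.degree * coeff α Ψ =
      ∑ α ∈ Ψ.support with α ∈ expLE m T, (∏ i, v i ^ α i) * p ^ α.degree * coeff α Ψ := by
    rw [Finset.filter_mem_eq_inter, Finset.inter_comm, ← Finset.filter_mem_eq_inter]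
    refine (Finset.sum_filter_of_ne fun α _ h => ?_).symm
    exact mem_support_iff.2 (right_ne_zero_of_mul h)
  rw [h1, h2, ← Finset.sum_filter_add_sum_filter_not Ψ.support (· ∈ expLE m T), add_sub_cancel_left]
  refine Finset.dvd_sum fun α hα => ?_
  rw [Finset.mem_filter, mem_expLE, not_le] at hα
  exact ((pow_dvd_pow p hα.2.le).mul_left _).mul_right _

theorem pow_dvd_det_of_congr {m : ℕ} {ι : Type*} [Fintype ι] [DecidableEq ι] {p : ℤ}
    {a : Fin m → ℤ} {y : ι → Fin m → ℤ} (hy : ∀ k i, p ∣ y k i - a i) {T E : ℕ}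
    (Φ : ι → MvPolynomial (Fin m) ℤ) {M : Matrix ι ι ℤ}
    (hM : ∀ k i, p ^ T ∣ M k i - eval (y k) (Φ i))
    (hE : E + (T + m).choose (m + 1) ≤ T * Fintype.card ι) : p ^ E ∣ M.det := by
  choose v hv using hy
  choose c hc using fun i => exists_local_expansion (Φ i) p a T
  have hM' : ∀ k i, p ^ T ∣ M k i -
      ∑ α ∈ expLE m T, (∏ j, v k j ^ α j) * p ^ α.degree * c i α := by
    intro k i
    have h1 : y k = fun j => a j + p * v k j := by
      ext j
      linarith [hv k j]
    have := dvd_add (hM k i) (hc i (v k))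
    rwa [h1, sub_add_sub_cancel] at this
  choose R hR using hM'
  let w : (expLE m T) ⊕ ι → ℕ := Sum.elim (fun α => α.1.degree) fun _ => T
  have hw : ∀ j, w j ≤ T := by
    rintro (α | k)
    · exact mem_expLE.1 α.2
    · exact le_rfl
  refine pow_dvd_det_of_forall_injective (w := w) (fun σ hσ => ?_)
    (fun k => Sum.elim (fun α => ∏ j, v k j ^ α.1 j) fun k' => if k = k' then 1 else 0)
    (Sum.elim (fun α i => c i α.1) fun k' i => R k' i) fun k i => ?_
  · have h1 : ∑ i, (T - w (σ i)) ≤ (T + m).choose (m + 1) := by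
      calc ∑ i, (T - w (σ i)) = ∑ j ∈ Finset.univ.map ⟨σ, hσ⟩, (T - w j) := by
            rw [Finset.sum_map]; rfl
        _ ≤ ∑ j, (T - w j) := Finset.sum_le_sum_of_subset (Finset.subset_univ _)
        _ = ∑ α ∈ expLE m T, (T - α.degree) := by
            rw [Fintype.sum_sum_type, ← Finset.sum_coe_sort (expLE m T)]
            simp [w]
        _ = (T + m).choose (m + 1) := by
            have h2 : ∑ α ∈ expLE m T, (T - α.degree) + ∑ α ∈ expLE m T, α.degree =
                T * (T + m).choose m := by
              rw [← Finset.sum_add_distrib, Finset.sum_congr rfl fun α hα =>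
                Nat.sub_add_cancel (mem_expLE.1 hα), Finset.sum_const, card_expLE, smul_eq_mul,
                mul_comm]
            have := sum_degree_expLE m T
            omega
    have h2 : ∑ i, (T - w (σ i)) + ∑ i, w (σ i) = T * Fintype.card ι := by
      rw [← Finset.sum_add_distrib, Finset.sum_congr rfl fun i _ => Nat.sub_add_cancel (hw (σ i)),
        Finset.sum_const, Finset.card_univ, smul_eq_mul, mul_comm]
    omega
  · have := hR k i
    rw [← Finset.sum_coe_sort (expLE m T)] at this
    rw [Fintype.sum_sum_type, ← sub_eq_iff_eq_add']
    simpa [w] using this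

end Congruences

section Covering

open MvPolynomial

theorem totalDegree_le_of_support_subset {σ R : Type*} [CommSemiring R] {f : MvPolynomial σ R}
    {D : ℕ} (h : ∀ γ ∈ f.support, γ.degree ≤ D) : f.totalDegree ≤ D :=
  Finset.sup_le h

theorem abs_prod_pow_le {r : ℕ} {B : ℕ} {x : Fin r → ℤ} (hx : ∀ i, |x i| ≤ B) (γ : Fin r →₀ ℕ) :
    |∏ i, x i ^ γ i| ≤ (B : ℤ) ^ γ.degree := by
  rw [Finset.abs_prod, Finsupp.degree_eq_sum, ← Finset.prod_pow_eq_pow_sum]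
  refine Finset.prod_le_prod (fun _ _ => abs_nonneg _) fun i _ => ?_
  rw [abs_pow]
  exact pow_le_pow_left₀ (abs_nonneg _) (hx i) _

/-- A set of integer points at which all the maximal minors of a matrix of monomials vanish lies on a
hypersurface with coefficients of bounded size. -/
theorem exists_polynomial_of_det_eq_zero {r B D : ℕ} (hB : 1 ≤ B) (Γ : Finset (Fin r →₀ ℕ))
    (hΓ : ∀ γ ∈ Γ, γ.degree ≤ D) {Z : Set (Fin r → ℤ)} (hZ : ∀ x ∈ Z, ∀ i, |x i| ≤ B)
    (hdet : ∀ s : Γ → Z, (Matrix.of fun k γ : Γ => ∏ i, (s k).1 i ^ γ.1 i).det = 0) :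
    ∃ h : MvPolynomial (Fin r) ℤ, h ≠ 0 ∧ h.support ⊆ Γ ∧
      (∀ γ, |coeff γ h| ≤ ((Γ.card * B ^ D) ^ Γ.card : ℕ)) ∧ ∀ x ∈ Z, eval x h = 0 := by
  classical
  obtain ⟨c, hc0, hcb, hc⟩ := exists_int_relation (P := Z) (ι := Γ)
    (fun x γ => ∏ i, x.1 i ^ γ.1 i) (Nat.one_le_pow D B hB) (fun x γ => by
      refine (abs_prod_pow_le (hZ x.1 x.2) γ.1).trans ?_
      push_cast
      exact pow_le_pow_right₀ (by exact_mod_cast hB) (hΓ _ γ.2)) hdet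
  rw [Fintype.card_coe] at hcb
  let h : MvPolynomial (Fin r) ℤ := ∑ γ : Γ, monomial γ.1 (c γ)
  have hcoeff : ∀ γ (hγ : γ ∈ Γ), coeff γ h = c ⟨γ, hγ⟩ := by
    intro γ hγ
    rw [coeff_sum, Finset.sum_eq_single ⟨γ, hγ⟩]
    · simp
    · intro δ _ hne
      rw [coeff_monomial, if_neg fun e => hne (Subtype.ext e)]
    · simp
  have hcoeff' : ∀ γ, γ ∉ Γ → coeff γ h = 0 := by
    intro γ hγ
    rw [coeff_sum]
    refine Finset.sum_eq_zero fun δ _ => ?_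
    rw [coeff_monomial, if_neg]
    rintro rfl
    exact hγ δ.2
  refine ⟨h, ?_, ?_, ?_, ?_⟩
  · intro h0
    refine hc0 (funext fun γ => ?_)
    rw [← hcoeff γ.1 γ.2, h0, coeff_zero, Pi.zero_apply]
  · intro γ hγ
    by_contra hne
    exact mem_support_iff.1 hγ (hcoeff' γ hne)
  · intro γ
    by_cases hγ : γ ∈ Γ
    · rw [hcoeff γ hγ]
      exact hcb _
    · rw [hcoeff' γ hγ, abs_zero]
      positivity
  · intro x hx
    rw [← hc ⟨x, hx⟩, map_sum]
    refine Finset.sum_congr rfl fun γ _ => ?_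
    rw [eval_monomial, Finsupp.prod_fintype _ _ (by simp), mul_comm]

theorem det_eq_zero_of_real_relation {r D : ℕ} {f : MvPolynomial (Fin r) ℝ} (hf0 : f ≠ 0)
    (hfD : f.totalDegree ≤ D) {Z : Set (Fin r → ℤ)}
    (hf : ∀ x ∈ Z, eval (fun i => (x i : ℝ)) f = 0) (s : expLE r D → Z) :
    (Matrix.of fun k γ : expLE r D => ∏ i, (s k).1 i ^ γ.1 i).det = 0 := by
  have hsupp : f.support ⊆ expLE r D := fun γ hγ =>
    mem_expLE.2 ((le_totalDegree hγ).trans hfD)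
  suffices h : ((Matrix.of fun k γ : expLE r D => ∏ i, (s k).1 i ^ γ.1 i).map
      (Int.castRingHom ℝ)).det = 0 by
    rw [← RingHom.mapMatrix_apply, ← RingHom.map_det] at h
    exact Int.cast_eq_zero.1 h
  refine Matrix.exists_mulVec_eq_zero_iff.1 ⟨fun γ => coeff γ.1 f, ?_, ?_⟩
  · obtain ⟨γ, hγ⟩ := support_nonempty.2 hf0
    intro h0
    exact mem_support_iff.1 hγ (congrFun h0 ⟨γ, hsupp hγ⟩)
  · ext k
    rw [Pi.zero_apply, ← hf _ (s k).2, eval_eq', Matrix.mulVec, dotProduct,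
      Finset.sum_subset hsupp fun γ _ h => by rw [notMem_support_iff.1 h, zero_mul],
      ← Finset.sum_coe_sort (expLE r D)]
    refine Finset.sum_congr rfl fun γ _ => ?_
    simp [mul_comm]

/-- The exponent vectors of degree less than `d` in the first variable and of degree at most `s` in
the others. -/
noncomputable def boxExp (m d s : ℕ) : Finset (Fin (m + 1) →₀ ℕ) :=
  (Finset.range d ×ˢ expLE m s).map ⟨fun q => Finsupp.cons q.1 q.2, fun q q' h => by
    obtain ⟨h1, h2⟩ := Finsupp.cons_injective2 h
    exact Prod.ext h1 h2⟩

theorem degree_eq_add_tail {m : ℕ} (γ : Fin (m + 1) →₀ ℕ) :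
    γ.degree = γ 0 + γ.tail.degree := by
  rw [Finsupp.degree_eq_sum, Finsupp.degree_eq_sum, Fin.sum_univ_succ]
  rfl

theorem mem_boxExp {m d s : ℕ} {γ : Fin (m + 1) →₀ ℕ} :
    γ ∈ boxExp m d s ↔ γ 0 < d ∧ γ.tail.degree ≤ s := by
  simp only [boxExp, Finset.mem_map, Finset.mem_product, Finset.mem_range, mem_expLE,
    Prod.exists]
  constructor
  · rintro ⟨k, α, h, rfl⟩
    change (Finsupp.cons k α) 0 < d ∧ (Finsupp.cons k α).tail.degree ≤ s
    rwa [Finsupp.cons_zero, Finsupp.tail_cons]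
  · intro h
    exact ⟨γ 0, γ.tail, h, γ.cons_tail⟩

theorem card_boxExp (m d s : ℕ) : (boxExp m d s).card = d * (s + m).choose m := by
  rw [boxExp, Finset.card_map, Finset.card_product, Finset.card_range, card_expLE]

theorem sum_degree_boxExp_le (m d s : ℕ) :
    ∑ γ ∈ boxExp m d s, γ.degree ≤
      d * ∑ α ∈ expLE m s, α.degree + d * (d * (s + m).choose m) := by
  rw [boxExp, Finset.sum_map, Finset.sum_product]
  have : ∀ k ∈ Finset.range d, ∑ α ∈ expLE m s, (Finsupp.cons k α).degree ≤
      d * (s + m).choose m + ∑ α ∈ expLE m s, α.degree := by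
    intro k hk
    simp only [degree_eq_add_tail, Finsupp.cons_zero, Finsupp.tail_cons, Finset.sum_add_distrib,
      Finset.sum_const, card_expLE, smul_eq_mul]
    rw [mul_comm]
    gcongr
    exact (Finset.mem_range.1 hk).le
  refine (Finset.sum_le_card_nsmul _ _ _ this).trans ?_
  rw [Finset.card_range, smul_eq_mul, mul_add, add_comm]

theorem exists_polynomial_of_class {m d s T E B : ℕ} (hd : d ≠ 0) (hB : 1 ≤ B) {p : ℕ}
    (hp : p.Prime)
    (hE : E + (T + 1 + m).choose (m + 1) ≤ (T + 1) * (d * (s + m).choose m))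
    (hpE : (d * (s + m).choose m).factorial * B ^ ∑ γ ∈ boxExp m d s, γ.degree < p ^ E)
    {G : MvPolynomial (Fin (m + 1)) ℤ} {Z : Set (Fin (m + 1) → ℤ)}
    (hZG : ∀ x ∈ Z, eval x G = 0) (hZ : ∀ x ∈ Z, ∀ i, |x i| ≤ B)
    (hZp : ∀ x ∈ Z, ¬ (p : ℤ) ∣ eval x (pderiv 0 G))
    (hcongr : ∀ x ∈ Z, ∀ y ∈ Z, ∀ i, (p : ℤ) ∣ x i - y i) :
    ∃ h : MvPolynomial (Fin (m + 1)) ℤ, h ≠ 0 ∧ degreeOf 0 h < d ∧ h.totalDegree ≤ d + s ∧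
      ∀ x ∈ Z, eval x h = 0 := by
  classical
  have hbox : ∀ γ ∈ boxExp m d s, γ.degree ≤ d + s := fun γ hγ => by
    rw [degree_eq_add_tail]
    exact add_le_add (mem_boxExp.1 hγ).1.le (mem_boxExp.1 hγ).2
  obtain ⟨h, h0, hsupp, -, hh⟩ := exists_polynomial_of_det_eq_zero hB (boxExp m d s) hbox hZ
    fun σ => by
      set M : Matrix (boxExp m d s) (boxExp m d s) ℤ :=
        Matrix.of fun k γ => ∏ i, (σ k).1 i ^ γ.1 i with hM
      have k₀ : boxExp m d s := ⟨0, mem_boxExp.2 ⟨Nat.pos_of_ne_zero hd, by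
        rw [show Finsupp.tail (0 : Fin (m + 1) →₀ ℕ) = 0 by ext; rfl, map_zero]; exact s.zero_le⟩⟩
      have hcop : IsCoprime (eval (σ k₀).1 (pderiv 0 G)) (p : ℤ) :=
        ((Nat.prime_iff_prime_int.1 hp).coprime_iff_not_dvd.2 (hZp _ (σ k₀).2)).symm
      obtain ⟨φ, hφ⟩ := exists_local_parametrization G hcop T
      have hdvd : (p : ℤ) ^ E ∣ M.det := by
        refine pow_dvd_det_of_congr (T := T + 1) (a := Fin.tail (σ k₀).1)
          (y := fun k => Fin.tail (σ k).1) (fun k i => hcongr _ (σ k).2 _ (σ k₀).2 _)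
          (fun γ => φ ^ γ.1 0 * monomial γ.1.tail 1) (fun k γ => ?_)
          (by rwa [Fintype.card_coe, card_boxExp])
        have h1 : M k γ = (σ k).1 0 ^ γ.1 0 * ∏ i, Fin.tail (σ k).1 i ^ γ.1.tail i := by
          rw [hM, Matrix.of_apply, Fin.prod_univ_succ]
          rfl
        rw [h1, map_mul, map_pow, eval_monomial, Finsupp.prod_fintype _ _ (by simp), one_mul,
          ← sub_mul]
        exact ((hφ _ (hZG _ (σ k).2) fun i => hcongr _ (σ k).2 _ (σ k₀).2 i).trans
          (sub_dvd_pow_sub_pow _ _ _)).mul_right _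
      refine Int.eq_zero_of_abs_lt_dvd hdvd ?_
      refine (abs_det_le_factorial_mul_prod (M := M) (b := fun γ => (B : ℤ) ^ γ.1.degree)
        fun k γ => abs_prod_pow_le (hZ _ (σ k).2) γ.1).trans_lt ?_
      rw [Finset.prod_pow_eq_pow_sum, Finset.sum_coe_sort (boxExp m d s) fun γ => γ.degree,
        Fintype.card_coe, card_boxExp]
      exact_mod_cast hpE
  refine ⟨h, h0, (degreeOf_lt_iff (Nat.pos_of_ne_zero hd)).2 fun γ hγ =>
    (mem_boxExp.1 (hsupp hγ)).1, totalDegree_le_of_support_subset fun γ hγ =>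
    hbox γ (hsupp hγ), hh⟩

theorem card_zeros_pderiv_ne_zero_le {K : Type*} [Field K] [Fintype K] [DecidableEq K] {m : ℕ}
    (g : MvPolynomial (Fin (m + 1)) K) :
    {a : Fin (m + 1) → K | eval a g = 0 ∧ eval a (pderiv 0 g) ≠ 0}.toFinset.card ≤
      Fintype.card K ^ m * degreeOf 0 g := by
  let q : (Fin m → K) → Polynomial K := fun y => (finSuccEquiv K m g).map (eval y)
  have hsub : {a : Fin (m + 1) → K | eval a g = 0 ∧ eval a (pderiv 0 g) ≠ 0}.toFinset ⊆
      (Finset.univ : Finset (Fin m → K)).biUnion fun y =>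
        (q y).roots.toFinset.image fun b => Fin.cons b y := by
    intro a ha
    rw [Set.mem_toFinset, Set.mem_ofPred_eq, eval_eq_eval_finSuccEquiv, eval_eq_eval_finSuccEquiv,
      finSuccEquiv_pderiv_zero, ← Polynomial.derivative_map] at ha
    refine Finset.mem_biUnion.2 ⟨Fin.tail a, Finset.mem_univ _, Finset.mem_image.2
      ⟨a 0, ?_, Fin.cons_self_tail a⟩⟩
    rw [Multiset.mem_toFinset, Polynomial.mem_roots']
    refine ⟨fun h0 => ha.2 ?_, ha.1⟩
    rw [show (finSuccEquiv K m g).map (eval (Fin.tail a)) = 0 from h0]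
    simp
  refine (Finset.card_le_card hsub).trans ?_
  refine (Finset.card_biUnion_le_card_mul _ _ (degreeOf 0 g) fun y _ => ?_).trans ?_
  · refine Finset.card_image_le.trans ((Multiset.toFinset_card_le _).trans
      ((Polynomial.card_roots' _).trans (Polynomial.natDegree_map_le.trans ?_)))
    rw [natDegree_finSuccEquiv]
  · simp

theorem exists_cover_of_prime {m d s T E B : ℕ} (hd : d ≠ 0) (hB : 1 ≤ B) {p : ℕ}
    (hp : p.Prime)
    (hE : E + (T + 1 + m).choose (m + 1) ≤ (T + 1) * (d * (s + m).choose m))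
    (hpE : (d * (s + m).choose m).factorial * B ^ ∑ γ ∈ boxExp m d s, γ.degree < p ^ E)
    {G : MvPolynomial (Fin (m + 1)) ℤ} (hGd : degreeOf 0 G ≤ d) {Z : Set (Fin (m + 1) → ℤ)}
    (hZG : ∀ x ∈ Z, eval x G = 0) (hZ : ∀ x ∈ Z, ∀ i, |x i| ≤ B) :
    ∃ S : Finset (MvPolynomial (Fin (m + 1)) ℤ), S.card ≤ p ^ m * d ∧
      (∀ h ∈ S, h ≠ 0 ∧ degreeOf 0 h < d ∧ h.totalDegree ≤ d + s) ∧
      ∀ x ∈ Z, ¬ (p : ℤ) ∣ eval x (pderiv 0 G) → ∃ h ∈ S, eval x h = 0 := by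
  classical
  have : Fact p.Prime := ⟨hp⟩
  have key : ∀ a : Fin (m + 1) → ZMod p, ∃ h : MvPolynomial (Fin (m + 1)) ℤ,
      (h ≠ 0 ∧ degreeOf 0 h < d ∧ h.totalDegree ≤ d + s) ∧
      ∀ x ∈ Z, ¬ (p : ℤ) ∣ eval x (pderiv 0 G) → (fun i => (x i : ZMod p)) = a →
        eval x h = 0 := by
    intro a
    obtain ⟨h, h0, h1, h2, h3⟩ := exists_polynomial_of_class hd hB hp hE hpE (G := G)
      (Z := {x | x ∈ Z ∧ ¬ (p : ℤ) ∣ eval x (pderiv 0 G) ∧ (fun i => (x i : ZMod p)) = a})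
      (fun x hx => hZG x hx.1) (fun x hx => hZ x hx.1) (fun x hx => hx.2.1)
      (fun x hx y hy i => by
        rw [← ZMod.intCast_zmod_eq_zero_iff_dvd, Int.cast_sub, sub_eq_zero]
        exact congrFun (hx.2.2.trans hy.2.2.symm) i)
    exact ⟨h, ⟨h0, h1, h2⟩, fun x hx hx' hxa => h3 x ⟨hx, hx', hxa⟩⟩
  choose h hh hx using key
  let g := map (Int.castRingHom (ZMod p)) G
  have hcast : ∀ (x : Fin (m + 1) → ℤ) (f : MvPolynomial (Fin (m + 1)) ℤ),
      eval (fun i => (x i : ZMod p)) (map (Int.castRingHom (ZMod p)) f) =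
        ((eval x f : ℤ) : ZMod p) := by
    intro x f
    rw [eval_map]
    exact eval₂_comp_left (Int.castRingHom (ZMod p)) (RingHom.id ℤ) x f |>.symm
  refine ⟨{a : Fin (m + 1) → ZMod p | eval a g = 0 ∧ eval a (pderiv 0 g) ≠ 0}.toFinset.image h,
    ?_, ?_, ?_⟩
  · refine Finset.card_image_le.trans ((card_zeros_pderiv_ne_zero_le g).trans ?_)
    rw [ZMod.card]
    refine Nat.mul_le_mul_left _ (le_trans (degreeOf_le_iff.2 fun γ hγ => ?_) hGd)
    exact monomial_le_degreeOf _ (support_map_subset _ _ hγ)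
  · intro f hf
    obtain ⟨a, -, rfl⟩ := Finset.mem_image.1 hf
    exact hh a
  · intro x hxZ hxp
    refine ⟨_, Finset.mem_image.2 ⟨fun i => (x i : ZMod p), ?_, rfl⟩, hx _ x hxZ hxp rfl⟩
    rw [Set.mem_toFinset, Set.mem_ofPred_eq, pderiv_map, hcast, hcast, hZG x hxZ, Int.cast_zero]
    exact ⟨rfl, fun h0 => hxp ((ZMod.intCast_zmod_eq_zero_iff_dvd _ _).1 h0)⟩

end Covering

section Parameters

open Filter Topology

theorem exists_parameters {m d : ℕ} (hm : 1 ≤ m) (hd : d ≠ 0) {θ : ℝ}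
    (hθ : (d : ℝ) ^ (-(1 : ℝ) / m) < θ) :
    ∃ s T E : ℕ, E + (T + 1 + m).choose (m + 1) ≤ (T + 1) * (d * (s + m).choose m) ∧ 1 ≤ E ∧
      ((∑ γ ∈ boxExp m d s, γ.degree : ℕ) : ℝ) ≤ θ * E := by
  have hd0 : (0 : ℝ) < d := by exact_mod_cast Nat.pos_of_ne_zero hd
  have hm0 : (m : ℝ) ≠ 0 := by positivity
  set l : ℝ := (d : ℝ) ^ ((1 : ℝ) / m) with hl
  have hl0 : 0 < l := Real.rpow_pos_of_pos hd0 _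
  have hlm : l ^ m = d := by
    rw [hl, one_div, Real.rpow_inv_natCast_pow hd0.le (by omega)]
  have hθl : 1 < θ * l := by
    rw [neg_div, Real.rpow_neg hd0.le, inv_lt_iff_one_lt_mul₀ hl0] at hθ
    exact hθ
  have hθ0 : 0 < θ := (Real.rpow_pos_of_pos hd0 _).trans hθ
  let T : ℕ → ℕ := fun s => ⌊l * s⌋₊
  have hT : Tendsto (fun s : ℕ => (T s : ℝ) / s) atTop (𝓝 l) :=
    (tendsto_nat_floor_mul_div_atTop hl0.le).comp tendsto_natCast_atTop_atTop
  have hTtop : Tendsto T atTop atTop :=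
    tendsto_nat_floor_atTop.comp (tendsto_natCast_atTop_atTop.const_mul_atTop hl0)
  have hinv : Tendsto (fun s : ℕ => (1 : ℝ) / s) atTop (𝓝 0) :=
    tendsto_one_div_atTop_nhds_zero_nat
  have ha : Tendsto (fun s : ℕ => ((s + m).choose m : ℝ) / s ^ m) atTop (𝓝 (1 / m.factorial)) := by
    simpa using tendsto_choose_div_pow 0 m
  have hc : Tendsto (fun s : ℕ => ((T s + (m + 1)).choose (m + 1) : ℝ) / (T s : ℝ) ^ (m + 1)) atTop
      (𝓝 (1 / (m + 1).factorial)) := by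
    simpa [Function.comp_def] using (tendsto_choose_div_pow 0 (m + 1)).comp hTtop
  have hE : Tendsto (fun s : ℕ => θ * (((T s : ℝ) / s + 1 / s) * (d * (((s + m).choose m : ℝ) / s ^ m))
      - ((T s + (m + 1)).choose (m + 1) : ℝ) / (T s : ℝ) ^ (m + 1) * ((T s : ℝ) / s) ^ (m + 1)))
      atTop (𝓝 (θ * ((l + 0) * (d * (1 / m.factorial)) - 1 / (m + 1).factorial * l ^ (m + 1)))) :=
    (((hT.add hinv).mul (ha.const_mul _)).sub (hc.mul (hT.pow _))).const_mul _
  have hW : Tendsto (fun s : ℕ => d * (((s + m).choose m : ℝ) / s ^ m) * (m / (m + 1))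
      + d * (d * (((s + m).choose m : ℝ) / s ^ m)) * (1 / s))
      atTop (𝓝 (d * (1 / m.factorial) * (m / (m + 1)) + d * (d * (1 / m.factorial)) * 0)) :=
    ((ha.const_mul _).mul_const _).add (((ha.const_mul _).const_mul _).mul hinv)
  have hlt : (d * (1 / m.factorial) * (m / (m + 1)) + d * (d * (1 / m.factorial)) * 0 : ℝ) <
      θ * ((l + 0) * (d * (1 / m.factorial)) - 1 / (m + 1).factorial * l ^ (m + 1)) := by
    rw [Nat.factorial_succ, pow_succ, hlm]
    have hf : (0 : ℝ) < m.factorial := by positivity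
    have h1 : θ * ((l + 0) * (d * (1 / m.factorial)) - 1 / ((m + 1) * m.factorial : ℕ) * (d * l)) =
        (θ * l) * (d * (1 / m.factorial) * (m / (m + 1))) := by
      push_cast
      field_simp
      ring
    rw [h1, mul_zero, add_zero]
    refine lt_mul_of_one_lt_left ?_ hθl
    positivity
  obtain ⟨s, ⟨hs, hs0⟩, hTs⟩ := (((hW.eventually_lt hE hlt).and (eventually_gt_atTop 0)).and
    (hTtop.eventually_gt_atTop 0)).exists
  have hs0' : (0 : ℝ) < s := by exact_mod_cast hs0
  have hTs' : (0 : ℝ) < T s := by exact_mod_cast hTs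
  set N : ℕ := (s + m).choose m with hN
  set c : ℕ := (T s + (m + 1)).choose (m + 1) with hcdef
  have hsum : ((∑ α ∈ expLE m s, α.degree : ℕ) : ℝ) = s * N * (m / (m + 1)) := by
    have h1 := sum_degree_expLE m s
    have h2 := Nat.choose_succ_right_eq (s + m) m
    rw [Nat.add_sub_cancel] at h2
    have h1' : ((∑ α ∈ expLE m s, α.degree : ℕ) : ℝ) + ((s + m).choose (m + 1) : ℕ) = s * N := by
      exact_mod_cast h1
    have h2' : (((s + m).choose (m + 1) : ℕ) : ℝ) * (m + 1) = N * s := by exact_mod_cast h2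
    field_simp
    linear_combination (m + 1 : ℝ) * h1' - h2'
  have hWle : ((∑ γ ∈ boxExp m d s, γ.degree : ℕ) : ℝ) ≤
      d * (s * N * (m / (m + 1))) + d * (d * N) := by
    rw [← hsum]
    exact_mod_cast sum_degree_boxExp_le m d s
  have hs' : d * (s * N * (m / (m + 1))) + d * (d * N) < θ * ((T s + 1) * (d * N) - c) := by
    have h1 : (d * (N / s ^ m) * (m / (m + 1)) + d * (d * (N / s ^ m)) * (1 / s) : ℝ) =
        (d * (s * N * (m / (m + 1))) + d * (d * N)) / s ^ (m + 1) := by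
      field_simp
      ring
    have h2 : θ * (((T s : ℝ) / s + 1 / s) * (d * (N / s ^ m)) -
        c / (T s : ℝ) ^ (m + 1) * ((T s : ℝ) / s) ^ (m + 1)) =
        θ * ((T s + 1) * (d * N) - c) / s ^ (m + 1) := by
      rw [div_pow, div_mul_div_cancel₀ (by positivity)]
      field_simp
      ring
    rw [h1, h2, div_lt_div_iff_of_pos_right (by positivity)] at hs
    exact hs
  have hEpos : (0 : ℝ) < (T s + 1) * (d * N) - c :=
    pos_of_mul_pos_right (lt_of_le_of_lt (by positivity) hs') hθ0.le
  have hEnat : c < (T s + 1) * (d * N) := by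
    have : (c : ℝ) < (T s + 1) * (d * N) := by linarith
    exact_mod_cast this
  refine ⟨s, T s, (T s + 1) * (d * N) - c, ?_, by omega, hWle.trans ?_⟩
  · rw [show T s + 1 + m = T s + (m + 1) by omega, ← hcdef]
    exact (Nat.sub_add_cancel hEnat.le).le
  · rw [Nat.cast_sub hEnat.le]
    push_cast
    exact hs'.le

end Parameters

section Primes

theorem exists_finset_primes {P : ℕ} (hP : P ≠ 0) (r : ℕ) :
    ∃ S : Finset ℕ, S.card = r ∧ ∀ p ∈ S, p.Prime ∧ P < p ∧ p ≤ 2 ^ r * P := by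
  induction r with
  | zero => exact ⟨∅, by simp⟩
  | succ r ih =>
    obtain ⟨S, hS, hSp⟩ := ih
    obtain ⟨q, hq, hlt, hle⟩ := Nat.exists_prime_lt_and_le_two_mul (2 ^ r * P) (by positivity)
    refine ⟨insert q S, ?_, fun p hp => ?_⟩
    · rw [Finset.card_insert_of_notMem fun h => (hSp q h).2.2.not_gt hlt, hS]
    · have h1 : P ≤ 2 ^ r * P := Nat.le_mul_of_pos_left P (by positivity)
      rw [pow_succ']
      rcases Finset.mem_insert.1 hp with rfl | hp
      · exact ⟨hq, by omega, by rw [mul_assoc]; exact hle⟩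
      · have := hSp p hp
        exact ⟨this.1, this.2.1, by rw [mul_assoc]; omega⟩

theorem exists_prime_not_dvd {P : ℕ} {S : Finset ℕ} (hS : ∀ p ∈ S, p.Prime ∧ P < p)
    {a : ℤ} (ha : a ≠ 0) (hlt : |a| < (P ^ S.card : ℕ)) : ∃ p ∈ S, ¬ (p : ℤ) ∣ a := by
  by_contra! h
  have h1 : ∏ p ∈ S, p ∣ a.natAbs :=
    Finset.prod_primes_dvd _ (fun p hp => (hS p hp).1.prime)
      fun p hp => Int.natCast_dvd.1 (h p hp)
  have h2 := Nat.le_of_dvd (Int.natAbs_pos.2 ha) h1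
  have h3 : P ^ S.card ≤ ∏ p ∈ S, p :=
    Finset.pow_card_le_prod _ _ _ fun p hp => (hS p hp).2.le
  rw [Int.abs_eq_natAbs] at hlt
  exact absurd hlt (by exact_mod_cast (h3.trans h2).not_gt)

end Primes

section Pderiv

open MvPolynomial

theorem pderiv_eq_sum {σ R : Type*} [CommSemiring R] (i : σ) (G : MvPolynomial σ R) :
    pderiv i G = ∑ γ ∈ G.support, monomial (γ - Finsupp.single i 1) (coeff γ G * (γ i : R)) := by
  conv_lhs => rw [G.as_sum, map_sum]
  simp only [pderiv_monomial]

theorem totalDegree_pderiv_le {σ R : Type*} [CommSemiring R] (i : σ) (G : MvPolynomial σ R) :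
    (pderiv i G).totalDegree ≤ G.totalDegree := by
  rw [pderiv_eq_sum]
  refine totalDegree_finsetSum_le fun γ hγ => (totalDegree_monomial_le _ _).trans ?_
  refine le_trans ?_ (le_totalDegree hγ)
  exact (Finsupp.degree_mono (tsub_le_self : γ - Finsupp.single i 1 ≤ γ))

theorem abs_eval_pderiv_le {r B D M A : ℕ} (hB : 1 ≤ B) {G : MvPolynomial (Fin r) ℤ}
    (hD : G.totalDegree ≤ D) (hM : G.support.card ≤ M) (hA : ∀ γ, |coeff γ G| ≤ A)
    {x : Fin r → ℤ} (hx : ∀ i, |x i| ≤ B) (i : Fin r) :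
    |eval x (pderiv i G)| ≤ (M * (A * D * B ^ D) : ℕ) := by
  rw [pderiv_eq_sum, map_sum]
  refine (Finset.abs_sum_le_sum_abs _ _).trans ?_
  refine (Finset.sum_le_card_nsmul _ _ ((A * D * B ^ D : ℕ) : ℤ) fun γ hγ => ?_).trans ?_
  · have hγD : γ.degree ≤ D := (le_totalDegree hγ).trans hD
    have h1 : (γ - Finsupp.single i 1).degree ≤ D :=
      (Finsupp.degree_mono (tsub_le_self : γ - Finsupp.single i 1 ≤ γ)).trans hγD
    have h2 : γ i ≤ D := (Finsupp.le_degree i γ).trans hγD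
    rw [eval_monomial, Finsupp.prod_fintype _ _ (by simp), abs_mul, abs_mul, Nat.abs_cast]
    push_cast
    have h3 := abs_prod_pow_le hx (γ - Finsupp.single i 1)
    have h4 : (B : ℤ) ^ (γ - Finsupp.single i 1).degree ≤ (B : ℤ) ^ D :=
      pow_le_pow_right₀ (by exact_mod_cast hB) h1
    gcongr
    · exact hA γ
    · exact h3.trans h4
  · rw [nsmul_eq_mul]
    push_cast
    gcongr

theorem degreeOf_pderiv_lt {m d : ℕ} {R : Type*} [CommRing R] [IsDomain R] [CharZero R]
    {G : MvPolynomial (Fin (m + 1)) R} (h1 : 1 ≤ degreeOf 0 G) (hd : degreeOf 0 G ≤ d) :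
    pderiv 0 G ≠ 0 ∧ degreeOf 0 (pderiv 0 G) < d := by
  rw [← natDegree_finSuccEquiv] at h1 hd
  constructor
  · intro h
    have h2 := congrArg (finSuccEquiv R m) h
    rw [finSuccEquiv_pderiv_zero, map_zero] at h2
    have := Polynomial.derivative_eq_zero.1 h2
    omega
  · rw [← natDegree_finSuccEquiv, finSuccEquiv_pderiv_zero]
    exact (Polynomial.natDegree_derivative_lt (by omega)).trans_le hd

end Pderiv

section Cover

open MvPolynomial

theorem exists_cover_of_hypersurface {m d : ℕ} (hm : 1 ≤ m) (hd : d ≠ 0) {ε : ℝ} (hε : 0 < ε) :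
    ∃ C : ℕ, ∀ (Bad : Set (MvPolynomial (Fin (m + 1)) ℤ)) (Z : Set (Fin (m + 1) → ℤ)) (B : ℕ),
      1 ≤ B → (∀ g ≠ 0, degreeOf 0 g < d → g ∉ Bad) →
      (∃ f : MvPolynomial (Fin (m + 1)) ℝ, f ≠ 0 ∧ f.totalDegree ≤ d ∧
        ∀ x ∈ Z, eval (fun i => (x i : ℝ)) f = 0) →
      (∀ x ∈ Z, ∀ i, |x i| ≤ B) →
      ∃ S : Finset (MvPolynomial (Fin (m + 1)) ℤ),
        (S.card : ℝ) ≤ C * (B : ℝ) ^ (m * (d : ℝ) ^ (-(1 : ℝ) / m) + ε) ∧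
        (∀ g ∈ S, g ∉ Bad ∧ g.totalDegree ≤ C) ∧ ∀ x ∈ Z, ∃ g ∈ S, eval x g = 0 := by
  classical
  have hm0 : (0 : ℝ) < m := by exact_mod_cast hm
  have hd0 : (0 : ℝ) < d := by exact_mod_cast Nat.pos_of_ne_zero hd
  set θ : ℝ := (d : ℝ) ^ (-(1 : ℝ) / m) + ε / m with hθ
  have hθlt : (d : ℝ) ^ (-(1 : ℝ) / m) < θ := lt_add_of_pos_right _ (by positivity)
  have hθ0 : 0 < θ := (Real.rpow_pos_of_pos hd0 _).trans hθlt
  have hmθ : m * (d : ℝ) ^ (-(1 : ℝ) / m) + ε = θ * m := by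
    rw [hθ]
    field_simp
  obtain ⟨s, T, E, hE, hE1, hW⟩ := exists_parameters hm hd hθlt
  set N := (d * (s + m).choose m).factorial with hN
  set M := (expLE (m + 1) d).card with hM
  set r := M ^ (M + 1) * d + ⌈(d * M + d) / θ⌉₊ with hr
  refine ⟨1 + r * ((2 ^ r * (N + 2)) ^ m * d) + d + s, fun Bad Z B hB hBad hf hZ => ?_⟩
  rw [hmθ]
  have hB1 : (1 : ℝ) ≤ B := by exact_mod_cast hB
  have hB0 : (0 : ℝ) < B := by linarith
  have hBθ : 1 ≤ (B : ℝ) ^ θ := Real.one_le_rpow hB1 hθ0.le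
  have hBm : (B : ℝ) ^ (θ * m) = ((B : ℝ) ^ θ) ^ m := Real.rpow_mul_natCast hB0.le _ _
  obtain ⟨f, hf0, hfd, hfZ⟩ := hf
  obtain ⟨G, hG0, hGs, hGc, hGZ⟩ := exists_polynomial_of_det_eq_zero hB (expLE (m + 1) d)
    (fun γ hγ => mem_expLE.1 hγ) hZ (det_eq_zero_of_real_relation hf0 hfd hfZ)
  have hGd : G.totalDegree ≤ d := totalDegree_le_of_support_subset fun γ hγ => mem_expLE.1 (hGs hγ)
  by_cases hGBad : G ∉ Bad
  · refine ⟨{G}, ?_, ?_, fun x hx => ⟨G, by simp, hGZ x hx⟩⟩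
    · rw [Finset.card_singleton, hBm]
      push_cast
      have h1 : (1 : ℝ) ≤ ((B : ℝ) ^ θ) ^ m := one_le_pow₀ hBθ
      have h2 : (0 : ℝ) ≤ r * ((2 ^ r * (N + 2)) ^ m * d) := by positivity
      nlinarith [(Nat.cast_nonneg s : (0 : ℝ) ≤ s)]
    · intro g hg
      rw [Finset.mem_singleton.1 hg]
      exact ⟨hGBad, by omega⟩
  have hGdeg : d ≤ degreeOf 0 G := by
    by_contra! h
    exact hGBad (hBad G hG0 h)
  have hGdeg' : degreeOf 0 G ≤ d := (degreeOf_le_totalDegree _ _).trans hGd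
  obtain ⟨hD0, hDd⟩ := degreeOf_pderiv_lt (by omega : 1 ≤ degreeOf 0 G) hGdeg'
  set P := ⌈(N + 1) * (B : ℝ) ^ θ⌉₊ with hP
  have hPge : (N + 1) * (B : ℝ) ^ θ ≤ P := Nat.le_ceil _
  have hPle : (P : ℝ) ≤ (N + 2) * (B : ℝ) ^ θ := by
    have := (Nat.ceil_lt_add_one (by positivity : 0 ≤ (N + 1) * (B : ℝ) ^ θ)).le
    linarith
  have hN1 : (1 : ℝ) ≤ N := by exact_mod_cast Nat.factorial_pos _
  have hP0 : P ≠ 0 := by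
    have : (0 : ℝ) < P := lt_of_lt_of_le (by positivity) hPge
    exact_mod_cast this.ne'
  obtain ⟨Q, hQ, hQp⟩ := exists_finset_primes hP0 r
  have hpE : ∀ p ∈ Q, N * B ^ ∑ γ ∈ boxExp m d s, γ.degree < p ^ E := by
    intro p hp
    have h1 : (P : ℝ) ≤ p := by exact_mod_cast (hQp p hp).2.1.le
    have h2 : ((N : ℝ) + 1) * (B : ℝ) ^ (∑ γ ∈ boxExp m d s, γ.degree) ≤ (p : ℝ) ^ E := by
      calc ((N : ℝ) + 1) * (B : ℝ) ^ (∑ γ ∈ boxExp m d s, γ.degree)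
          ≤ ((N : ℝ) + 1) ^ E * ((B : ℝ) ^ θ) ^ E := by
            gcongr
            · exact le_self_pow₀ (by linarith) (by omega)
            · rw [← Real.rpow_mul_natCast hB0.le, ← Real.rpow_natCast]
              exact Real.rpow_le_rpow_of_exponent_le hB1 hW
        _ = ((N + 1) * (B : ℝ) ^ θ) ^ E := (mul_pow _ _ _).symm
        _ ≤ (p : ℝ) ^ E := by
            gcongr
            exact hPge.trans h1
    have h3 : (N + 1) * B ^ (∑ γ ∈ boxExp m d s, γ.degree) ≤ p ^ E := by exact_mod_cast h2
    refine lt_of_lt_of_le ?_ h3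
    exact Nat.mul_lt_mul_of_pos_right (Nat.lt_succ_self N) (by positivity)
  have hcov : ∀ p : Q, ∃ S : Finset (MvPolynomial (Fin (m + 1)) ℤ), S.card ≤ p.1 ^ m * d ∧
      (∀ h ∈ S, h ≠ 0 ∧ degreeOf 0 h < d ∧ h.totalDegree ≤ d + s) ∧
      ∀ x ∈ Z, ¬ (p.1 : ℤ) ∣ eval x (pderiv 0 G) → ∃ h ∈ S, eval x h = 0 := fun p =>
    exists_cover_of_prime hd hB (hQp p.1 p.2).1 hE (hpE p.1 p.2) hGdeg' hGZ hZ
  choose S hScard hSprop hScov using hcov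
  refine ⟨insert (pderiv 0 G) (Q.attach.biUnion S), ?_, ?_, ?_⟩
  · have h1 : (insert (pderiv 0 G) (Q.attach.biUnion S)).card ≤ 1 + r * ((2 ^ r * P) ^ m * d) := by
      refine (Finset.card_insert_le _ _).trans ?_
      rw [add_comm, ← hQ, ← Finset.card_attach (s := Q)]
      gcongr
      refine Finset.card_biUnion_le_card_mul _ _ _ fun p _ => (hScard p).trans ?_
      gcongr
      rw [Finset.card_attach, hQ]
      exact (hQp p.1 p.2).2.2
    have h2 : ((insert (pderiv 0 G) (Q.attach.biUnion S)).card : ℝ) ≤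
        1 + r * ((2 ^ r * P) ^ m * d) := by exact_mod_cast h1
    refine h2.trans ?_
    rw [hBm]
    have h3 : (1 : ℝ) ≤ ((B : ℝ) ^ θ) ^ m := one_le_pow₀ hBθ
    have h4 : (r * ((2 ^ r * P) ^ m * d) : ℝ) ≤
        r * ((2 ^ r * (N + 2)) ^ m * d) * ((B : ℝ) ^ θ) ^ m := by
      calc (r * ((2 ^ r * P) ^ m * d) : ℝ) ≤ r * ((2 ^ r * ((N + 2) * (B : ℝ) ^ θ)) ^ m * d) := by
            gcongr
        _ = _ := by rw [← mul_assoc (2 ^ r : ℝ), mul_pow _ ((B : ℝ) ^ θ)]; ring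
    push_cast
    nlinarith [(Nat.cast_nonneg s : (0 : ℝ) ≤ s)]
  · intro g hg
    rcases Finset.mem_insert.1 hg with rfl | hg
    · exact ⟨hBad _ hD0 hDd, ((totalDegree_pderiv_le 0 G).trans hGd).trans (by omega)⟩
    · obtain ⟨p, -, hp⟩ := Finset.mem_biUnion.1 hg
      obtain ⟨h1, h2, h3⟩ := hSprop p g hp
      exact ⟨hBad _ h1 h2, by omega⟩
  · intro x hx
    by_cases h0 : eval x (pderiv 0 G) = 0
    · exact ⟨_, Finset.mem_insert_self _ _, h0⟩
    have hlt : |eval x (pderiv 0 G)| < (P ^ Q.card : ℕ) := by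
      refine (abs_eval_pderiv_le hB hGd (Finset.card_le_card hGs) hGc (hZ x hx) 0).trans_lt ?_
      rw [hQ, ← hM]
      norm_cast
      have h1 : (d * M + d : ℝ) ≤ θ * r := by
        have h2 : ((d * M + d : ℝ) / θ) ≤ r := by
          refine (Nat.le_ceil _).trans ?_
          exact Nat.cast_le.2 (Nat.le_add_left _ _)
        rwa [div_le_iff₀' hθ0] at h2
      have h3 : (M ^ (M + 1) * d : ℝ) < 2 ^ r := by
        have : M ^ (M + 1) * d < 2 ^ r := lt_of_le_of_lt (Nat.le_add_right _ _) Nat.lt_two_pow_self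
        exact_mod_cast this
      have h4 : ((M * ((M * B ^ d) ^ M * d * B ^ d) : ℕ) : ℝ) < (P : ℝ) ^ r := by
        calc ((M * ((M * B ^ d) ^ M * d * B ^ d) : ℕ) : ℝ)
            = (M ^ (M + 1) * d) * (B : ℝ) ^ (d * M + d) := by
              push_cast
              rw [mul_pow, pow_add (B : ℝ), pow_mul]
              ring
          _ < 2 ^ r * (B : ℝ) ^ (d * M + d) := by gcongr
          _ ≤ 2 ^ r * ((B : ℝ) ^ θ) ^ r := by
              gcongr
              rw [← Real.rpow_mul_natCast hB0.le, ← Real.rpow_natCast]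
              exact Real.rpow_le_rpow_of_exponent_le hB1 (by exact_mod_cast h1)
          _ = (2 * (B : ℝ) ^ θ) ^ r := (mul_pow _ _ _).symm
          _ ≤ (P : ℝ) ^ r := by
              gcongr
              refine le_trans ?_ hPge
              gcongr
              linarith
      exact_mod_cast h4
    obtain ⟨p, hp, hpd⟩ :=
      exists_prime_not_dvd (fun p hp => ⟨(hQp p hp).1, (hQp p hp).2.1⟩) h0 hlt
    obtain ⟨h, hh, hx0⟩ := hScov ⟨p, hp⟩ x hx hpd
    exact ⟨h, Finset.mem_insert_of_mem (Finset.mem_biUnion.2 ⟨_, Finset.mem_attach _ _, hh⟩), hx0⟩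

end Cover

section Final

open MvPolynomial Filter Topology

theorem tendsto_div_pow_of_eventually_eq_eval {m d : ℕ} {h : ℕ → ℕ} {P : Polynomial ℚ}
    (hm : P.natDegree = m) (hP0 : P ≠ 0) (hP : P.leadingCoeff * (m.factorial : ℚ) = d)
    (hh : ∀ᶠ s : ℕ in atTop, (h s : ℚ) = P.eval (s : ℚ)) :
    Tendsto (fun s : ℕ => (h s : ℝ) / s ^ m) atTop (𝓝 (d / m.factorial)) := by
  set Q : Polynomial ℝ := P.map (algebraMap ℚ ℝ) with hQ
  have hlead : Q.leadingCoeff = d / m.factorial := by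
    rw [hQ, Polynomial.leadingCoeff_map, eq_div_iff (by positivity)]
    have := congrArg (algebraMap ℚ ℝ) hP
    simpa using this
  have hdeg : Q.degree = (Polynomial.X ^ m : Polynomial ℝ).degree := by
    rw [hQ, Polynomial.degree_map, Polynomial.degree_X_pow, Polynomial.degree_eq_natDegree hP0, hm]
  have key := (Polynomial.div_tendsto_atTop_leadingCoeff_div_of_degree_eq Q (Polynomial.X ^ m)
    hdeg).comp (tendsto_natCast_atTop_atTop (R := ℝ))
  rw [(Polynomial.monic_X_pow m).leadingCoeff, div_one, hlead] at key
  refine key.congr' ?_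
  filter_upwards [hh] with s hs
  have h1 : Q.eval (s : ℝ) = h s := by
    have h2 := congrArg (algebraMap ℚ ℝ) hs
    rw [← Polynomial.eval₂_at_apply] at h2
    rw [hQ, Polynomial.eval_map]
    simpa using h2.symm
  simp [h1]

theorem degLE_comp_algHom {k A L : Type*} [Field k] [CommRing A] [Algebra k A] [CommRing L]
    [Algebra k L] {r : ℕ} (φ : A →ₐ[k] L) (z : Fin r → A) (s : ℕ) :
    degLE k (fun i => φ (z i)) s = (degLE k z s).map φ.toLinearMap := by
  rw [degLE, degLE, ← Submodule.map_comp]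
  congr 1
  exact LinearMap.ext fun f => (comp_aeval_apply z φ f).symm

theorem exists_projection_of_isPrime {n m d : ℕ} (hd : d ≠ 0)
    {I : Ideal (MvPolynomial (Fin n) ℝ)} (hI : I.IsPrime)
    (hh : Tendsto (fun s : ℕ => (affineHilbertFn ℝ I s : ℝ) / s ^ m) atTop
      (𝓝 (d / m.factorial))) :
    ∃ ℓ : Fin (m + 1) → Fin n → ℤ, (∀ j i, |ℓ j i| ≤ (2 * d) ^ n + (d ^ 2 * n + 1) ^ n) ∧
      (∀ f : MvPolynomial (Fin (m + 1)) ℝ, f ≠ 0 → degreeOf 0 f < d →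
        aeval (fun j => ∑ i, (ℓ j i : MvPolynomial (Fin n) ℝ) * X i) f ∉ I) ∧
      ∃ f : MvPolynomial (Fin (m + 1)) ℝ, f ≠ 0 ∧ f.totalDegree ≤ d ∧
        aeval (fun j => ∑ i, (ℓ j i : MvPolynomial (Fin n) ℝ) * X i) f ∈ I := by
  let A := MvPolynomial (Fin n) ℝ ⧸ I
  let L := FractionRing A
  let φ : A →ₐ[ℝ] L := IsScalarTower.toAlgHom ℝ A L
  have hφ : Function.Injective φ := IsFractionRing.injective A L
  let π : MvPolynomial (Fin n) ℝ →ₐ[ℝ] L := φ.comp (Ideal.Quotient.mkₐ ℝ I)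
  have hπ : ∀ f, π f = 0 ↔ f ∈ I := fun f => by
    rw [← Ideal.Quotient.eq_zero_iff_mem]
    exact map_eq_zero_iff φ hφ
  have hx : IntermediateField.adjoin ℝ (Set.range fun i => π (X i)) = ⊤ := by
    rw [eq_top_iff]
    have hA : ∀ f, π f ∈ IntermediateField.adjoin ℝ (Set.range fun i => π (X i)) := fun f => by
      induction f using MvPolynomial.induction_on with
      | C a =>
        rw [← algebraMap_eq, AlgHom.commutes]
        exact IntermediateField.algebraMap_mem _ a
      | add p q hp hq => rw [map_add]; exact add_mem hp hq
      | mul_X p i hp =>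
        rw [map_mul]
        exact mul_mem hp (IntermediateField.subset_adjoin _ _ ⟨i, rfl⟩)
    intro y _
    obtain ⟨a, b, -, rfl⟩ := IsFractionRing.div_surjective (A := A) y
    obtain ⟨a, rfl⟩ := Ideal.Quotient.mk_surjective a
    obtain ⟨b, rfl⟩ := Ideal.Quotient.mk_surjective b
    exact div_mem (hA a) (hA b)
  have hfr : ∀ s, Module.finrank ℝ (degLE ℝ (fun i => π (X i)) s) = affineHilbertFn ℝ I s := by
    intro s
    rw [affineHilbertFn_eq]
    have h1 := degLE_comp_algHom φ (fun i => Ideal.Quotient.mk I (X i)) s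
    change Module.finrank ℝ (degLE ℝ (fun i => φ (Ideal.Quotient.mk I (X i))) s) = _
    rw [h1]
    exact (Submodule.equivMapOfInjective φ.toLinearMap hφ _).finrank_eq.symm
  obtain ⟨ℓ, hℓ, h1, f, hf0, hfd, hf⟩ := exists_hypersurface_projection (m := m) hd hx
    (by simpa only [hfr] using hh)
  have haeval : ∀ f : MvPolynomial (Fin (m + 1)) ℝ,
      π (aeval (fun j => ∑ i, (ℓ j i : MvPolynomial (Fin n) ℝ) * X i) f) =
        aeval (fun j => ∑ i, (ℓ j i : L) * π (X i)) f := fun f => by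
    rw [← AlgHom.comp_apply, comp_aeval]
    simp
  refine ⟨ℓ, hℓ, fun f h0 hd hf => h1 f h0 hd ?_, f, hf0, hfd, ?_⟩
  · rw [← haeval, hπ]
    exact hf
  · rw [← hπ, haeval]
    exact hf

theorem abs_sum_mul_le {n c b : ℕ} {ℓ x : Fin n → ℤ} (hℓ : ∀ i, |ℓ i| ≤ c)
    (hx : ∀ i, |x i| ≤ b) : |∑ i, ℓ i * x i| ≤ ((n * c + 1) * b : ℕ) := by
  refine (Finset.abs_sum_le_sum_abs _ _).trans ?_
  refine (Finset.sum_le_card_nsmul _ _ ((c * b : ℕ) : ℤ) fun i _ => ?_).trans ?_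
  · rw [abs_mul]
    push_cast
    gcongr
    · exact hℓ i
    · exact hx i
  · rw [Finset.card_univ, Fintype.card_fin, nsmul_eq_mul]
    norm_cast
    nlinarith

theorem exists_polynomial_of_fixed_dimension (n : ℕ) {m d : ℕ} (hm : 1 ≤ m) (hd : d ≠ 0) {ε : ℝ}
    (hε : 0 < ε) :
    ∃ C : ℕ, ∀ I : Ideal (MvPolynomial (Fin n) ℝ), I.IsPrime →
      Tendsto (fun s : ℕ => (affineHilbertFn ℝ I s : ℝ) / s ^ m) atTop (𝓝 (d / m.factorial)) →
      ∀ B : ℝ, 1 ≤ B →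
      ∃ g : MvPolynomial (Fin n) ℤ,
        map (Int.castRingHom ℝ) g ∉ I ∧
        (g.totalDegree : ℝ) ≤ C * B ^ (m * (d : ℝ) ^ (-(1 : ℝ) / m) + ε) ∧
        (∀ q : MvPolynomial (Fin n) ℤ, Irreducible q → q ∣ g → q.totalDegree ≤ C) ∧
        ∀ x : Fin n → ℤ, ((fun i => (x i : ℝ)) ∈ zeroSetOf I) →
          (∀ i, |(x i : ℝ)| ≤ B) → eval x g = 0 := by
  classical
  obtain ⟨C, hC⟩ := exists_cover_of_hypersurface hm hd hε
  set e : ℝ := m * (d : ℝ) ^ (-(1 : ℝ) / m) + ε with he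
  have he0 : 0 ≤ e := by positivity
  set c : ℕ := (2 * d) ^ n + (d ^ 2 * n + 1) ^ n with hc
  set K : ℕ := n * c + 1 with hK
  refine ⟨C * C * ⌈(K : ℝ) ^ e⌉₊ + C, fun I hI hh B hB => ?_⟩
  obtain ⟨ℓ, hℓ, hℓ1, f, hf0, hfd, hfI⟩ := exists_projection_of_isPrime hd hI hh
  let lin : Fin (m + 1) → MvPolynomial (Fin n) ℤ := fun j => ∑ i, MvPolynomial.C (ℓ j i) * X i
  let b : ℕ := ⌊B⌋₊
  have hb1 : 1 ≤ b := Nat.le_floor (by simpa using hB)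
  have hbB : (b : ℝ) ≤ B := Nat.floor_le (by linarith)
  have hlin : ∀ j, (lin j).totalDegree ≤ 1 := fun j =>
    totalDegree_finsetSum_le fun i _ => (totalDegree_mul _ _).trans
      (by rw [totalDegree_C, totalDegree_X])
  have hmap : ∀ g : MvPolynomial (Fin (m + 1)) ℤ, map (Int.castRingHom ℝ) (aeval lin g) =
      aeval (fun j => ∑ i, (ℓ j i : MvPolynomial (Fin n) ℝ) * X i)
        (map (Int.castRingHom ℝ) g) := fun g => by
    induction g using MvPolynomial.induction_on with
    | C a => simp
    | add p q hp hq => simp only [map_add, hp, hq]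
    | mul_X p i hp =>
      simp only [map_mul, hp, aeval_X, map_X]
      simp [lin]
  have heval : ∀ (x : Fin n → ℤ) (g : MvPolynomial (Fin (m + 1)) ℤ),
      eval x (aeval lin g) = eval (fun j => ∑ i, ℓ j i * x i) g := fun x g => by
    induction g using MvPolynomial.induction_on with
    | C a => simp
    | add p q hp hq => simp only [map_add, hp, hq]
    | mul_X p i hp =>
      simp only [map_mul, hp, aeval_X, eval_X]
      simp [lin]
  have hevalR : ∀ (x : Fin n → ℤ) (g : MvPolynomial (Fin (m + 1)) ℝ),
      eval (fun i => (x i : ℝ))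
        (aeval (fun j => ∑ i, (ℓ j i : MvPolynomial (Fin n) ℝ) * X i) g) =
        eval (fun j => ((∑ i, ℓ j i * x i : ℤ) : ℝ)) g := fun x g => by
    induction g using MvPolynomial.induction_on with
    | C a => simp
    | add p q hp hq => simp only [map_add, hp, hq]
    | mul_X p i hp =>
      simp only [map_mul, hp, aeval_X, eval_X]
      simp
  obtain ⟨S, hScard, hSprop, hSZ⟩ := hC
    {g | map (Int.castRingHom ℝ) (aeval lin g) ∈ I}
    {y | ∃ x : Fin n → ℤ, (fun i => (x i : ℝ)) ∈ zeroSetOf I ∧ (∀ i, |x i| ≤ b) ∧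
      y = fun j => ∑ i, ℓ j i * x i}
    (K * b) (Nat.mul_pos (Nat.succ_pos _) hb1)
    (fun g hg0 hgd hg => by
      refine hℓ1 (map (Int.castRingHom ℝ) g) ?_ ?_ (hmap g ▸ hg)
      · rw [Ne, map_eq_zero_iff _ (map_injective _ Int.cast_injective)]
        exact hg0
      · rwa [degreeOf, degrees_map_of_injective _ Int.cast_injective])
    ⟨f, hf0, hfd, by
      rintro _ ⟨x, hx, -, rfl⟩
      rw [← hevalR]
      exact hx _ hfI⟩
    (by
      rintro _ ⟨x, -, hx, rfl⟩ j
      exact abs_sum_mul_le (fun i => by exact_mod_cast hℓ j i) hx)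
  have hdeg : ∀ h ∈ S, (aeval lin h).totalDegree ≤ C := fun h hh =>
    (totalDegree_aeval_le_mul lin 1 hlin h).trans (by simpa using (hSprop h hh).2)
  have hne : ∀ h ∈ S, aeval lin h ≠ 0 := fun h hh h0 =>
    (hSprop h hh).1 (by rw [Set.mem_ofPred_eq, h0, map_zero]; exact zero_mem I)
  refine ⟨∏ h ∈ S, aeval lin h, ?_, ?_, ?_, ?_⟩
  · rw [map_prod, hI.prod_mem_iff]
    rintro ⟨h, hh, hmem⟩
    exact (hSprop h hh).1 hmem
  · have h1 : (∏ h ∈ S, aeval lin h).totalDegree ≤ S.card * C :=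
      (totalDegree_finsetProd _ _).trans (Finset.sum_le_card_nsmul _ _ _ hdeg)
    have h2 : ((∏ h ∈ S, aeval lin h).totalDegree : ℝ) ≤ S.card * C := by exact_mod_cast h1
    have h3 : (((K * b : ℕ) : ℝ)) ^ e ≤ ⌈(K : ℝ) ^ e⌉₊ * B ^ e := by
      push_cast
      rw [Real.mul_rpow (by positivity) (by positivity)]
      gcongr
      exact Nat.le_ceil _
    have hBe : (0 : ℝ) ≤ B ^ e := Real.rpow_nonneg (by linarith) _
    calc ((∏ h ∈ S, aeval lin h).totalDegree : ℝ) ≤ S.card * C := h2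
      _ ≤ (C * (⌈(K : ℝ) ^ e⌉₊ * B ^ e)) * C := by
          gcongr
          exact hScard.trans (by gcongr)
      _ ≤ ((C * C * ⌈(K : ℝ) ^ e⌉₊ + C : ℕ) : ℝ) * B ^ e := by
          push_cast
          nlinarith [mul_nonneg (Nat.cast_nonneg C : (0 : ℝ) ≤ C) hBe]
  · intro q hq hqg
    obtain ⟨h, hh, hqh⟩ := hq.prime.exists_mem_finset_dvd hqg
    exact ((totalDegree_le_of_dvd_of_isDomain hqh (hne h hh)).trans (hdeg h hh)).trans
      (Nat.le_add_left _ _)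
  · intro x hx hxB
    have hxb : ∀ i, |x i| ≤ b := fun i => by
      rw [Int.abs_eq_natAbs]
      have h1 : ((x i).natAbs : ℝ) ≤ B := by rw [Nat.cast_natAbs]; exact_mod_cast hxB i
      exact_mod_cast Nat.le_floor h1
    obtain ⟨h, hh, h0⟩ := hSZ _ ⟨x, hx, hxb, rfl⟩
    rw [map_prod]
    exact Finset.prod_eq_zero hh (by rw [heval, h0])

end Final

/-- **Theorem 1.1.**  Let `X ⊆ 𝔸^n_ℝ` be an irreducible closed subvariety of dimension
`m ≥ 1` and degree `d` (encoded by its vanishing ideal `I = I(X)`: a real prime ideal of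
Krull codimension data `dim ℝ[x]/I = m`, whose affine Hilbert function agrees for large
`s` with a polynomial `P` of degree `m` and `P.leadingCoeff·m! = d`).  Then for every
`ε > 0` there is a constant `C = C(n,d,ε)` such that for every `B ≥ 1` there is a
polynomial `g ∈ ℤ[x_1,…,x_n] \ I` of degree `≤ C·B^{m·d^{−1/m}+ε}`, all of whose
irreducible factors have degree at most `C`, vanishing at every point of `X(ℤ,B)`. -/
theorem affine_determinant_method (n d : ℕ) (ε : ℝ) (hε : 0 < ε) :
    ∃ C : ℝ, ∀ (m : ℕ), 1 ≤ m →
      ∀ (I : Ideal (MvPolynomial (Fin n) ℝ)) (P : Polynomial ℚ),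
      I.IsPrime → I = vanishingIdeal (zeroSetOf I) →
      ringKrullDim (MvPolynomial (Fin n) ℝ ⧸ I) = (m : WithBot (WithTop ℕ)) →
      P.natDegree = m → P.leadingCoeff * (Nat.factorial m : ℚ) = (d : ℚ) →
      (∀ᶠ s : ℕ in Filter.atTop, (affineHilbertFn ℝ I s : ℚ) = P.eval (s : ℚ)) →
      ∀ B : ℝ, 1 ≤ B →
      ∃ g : MvPolynomial (Fin n) ℤ,
        MvPolynomial.map (Int.castRingHom ℝ) g ∉ I ∧
        (g.totalDegree : ℝ) ≤ C * B ^ ((m : ℝ) * (d : ℝ) ^ (-(1 : ℝ) / (m : ℝ)) + ε) ∧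
        (∀ q : MvPolynomial (Fin n) ℤ, Irreducible q → q ∣ g → (q.totalDegree : ℝ) ≤ C) ∧
        ∀ x : Fin n → ℤ, ((fun i => (x i : ℝ)) ∈ zeroSetOf I) →
          (∀ i, |(x i : ℝ)| ≤ B) → MvPolynomial.eval x g = 0 := by
  rcases eq_or_ne d 0 with rfl | hd
  · refine ⟨0, fun m hm I P _ _ _ hPm hP => ?_⟩
    rw [Nat.cast_zero, mul_eq_zero, Polynomial.leadingCoeff_eq_zero] at hP
    rcases hP with rfl | hP
    · rw [Polynomial.natDegree_zero] at hPm
      omega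
    · exact absurd hP (by positivity)
  have hex := fun m : ℕ => exists_polynomial_of_fixed_dimension n (m := m + 1) (by omega) hd hε
  choose C hC using hex
  refine ⟨((∑ m ∈ Finset.range n, C m : ℕ) : ℝ), fun m hm I P hI _ _ hPm hP hev B hB => ?_⟩
  obtain ⟨m, rfl⟩ := Nat.exists_eq_add_of_le' hm
  have hP0 : P ≠ 0 := by
    rintro rfl
    simp at hPm
  have hh := tendsto_div_pow_of_eventually_eq_eval hPm hP0 hP hev
  have hmn : m + 1 ≤ n := le_exponent_of_hilbert_le_choose hd hh (c := 1) fun s => by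
    rw [affineHilbertFn_eq, one_mul]
    exact finrank_degLE_le _ _
  have hCle : C m ≤ ∑ m ∈ Finset.range n, C m :=
    Finset.single_le_sum (fun _ _ => Nat.zero_le _) (Finset.mem_range.2 hmn)
  obtain ⟨g, hgI, hgd, hgq, hgx⟩ := hC m I hI hh B hB
  refine ⟨g, hgI, hgd.trans ?_, fun q hq hqg => ?_, hgx⟩
  · have : (0 : ℝ) ≤ B ^ (((m + 1 : ℕ) : ℝ) * (d : ℝ) ^ (-(1 : ℝ) / ((m + 1 : ℕ) : ℝ)) + ε) :=
      Real.rpow_nonneg (by linarith) _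
    gcongr
  · exact_mod_cast (hgq q hq hqg).trans hCle
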